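/- Fix 0 < R₁ < R₂. There exists a constant C > 0 such that for all δ ∈ (0, π/2): λ₂(B_{R₂}) ≤ λ₂(B_{R₂} \ K_δ) ≤ λ₂(B_{R₂}) + C δ². (Equivalently, with ε = π/2 − δ, the lowest eigenvalue λ₁^{NDD} of the cracked quarter-disk with a Neumann condition on θ = 0 and a Dirichlet condition on θ = π/2 satisfies λ₂(B_{R₂}) ≤ λ₁^{NDD} ≤ λ₂(B_{R₂}) + C(π/2 − ε)².) -/

import Mathlib

open MeasureTheory Real Set

noncomputable section

/-- A Dirichlet test function on `ω`: smooth, compactly supported, with support in `ω`. -/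
def testFun (ω : Set (ℝ × ℝ)) (u : (ℝ × ℝ) → ℝ) : Prop :=
  ContDiff ℝ (⊤ : ℕ∞) u ∧ HasCompactSupport u ∧ tsupport u ⊆ ω

/-- `|∇u|²` at a point. -/
def gradSq (u : (ℝ × ℝ) → ℝ) (x : ℝ × ℝ) : ℝ :=
  fderiv ℝ u x (1, 0) ^ 2 + fderiv ℝ u x (0, 1) ^ 2

/-- The Rayleigh quotient of `u` on `ω`. -/
def rayleigh (ω : Set (ℝ × ℝ)) (u : (ℝ × ℝ) → ℝ) : ℝ :=
  (∫ x in ω, gradSq u x) / ∫ x in ω, u x ^ 2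

/-- The `k`-th Dirichlet eigenvalue of `ω` (`k ≥ 1`), via the Courant–Fischer
min-max formula over `k`-dimensional subspaces of `C_c^∞(ω)`. -/
def dirichletEV (ω : Set (ℝ × ℝ)) (k : ℕ) : ℝ :=
  sInf {l | ∃ V : Submodule ℝ ((ℝ × ℝ) → ℝ),
    (V : Set ((ℝ × ℝ) → ℝ)) ⊆ {u | testFun ω u} ∧ Module.finrank ℝ V = k ∧
    l = sSup {r | ∃ u ∈ V, u ≠ 0 ∧ r = rayleigh ω u}}

/-- The open disk `B_R` centered at the origin. -/
def disk (R : ℝ) : Set (ℝ × ℝ) := {x | x.1 ^ 2 + x.2 ^ 2 < R ^ 2}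

/-- The open annulus `M_{R₁,R₂} = B_{R₂} \ closure (B_{R₁})`. -/
def annulus (R₁ R₂ : ℝ) : Set (ℝ × ℝ) := disk R₂ \ closure (disk R₁)

/-- `D_{R₁,R₂} = B_{R₁} ∪ M_{R₁,R₂}`. -/
def diskUnionAnnulus (R₁ R₂ : ℝ) : Set (ℝ × ℝ) := disk R₁ ∪ annulus R₁ R₂

/-- The cracked domain `𝔇(N,ε)`. -/
def crackedDomain (R₁ R₂ : ℝ) (N : ℕ) (ε : ℝ) : Set (ℝ × ℝ) :=
  diskUnionAnnulus R₁ R₂ ∪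
    ⋃ j ∈ Finset.range N, {x | ∃ θ : ℝ, θ ∈ Set.Ioo (2 * π * j / N - ε) (2 * π * j / N + ε) ∧
      x = (R₁ * Real.cos θ, R₁ * Real.sin θ)}

/-- The open upper half-disk `B_R⁺ = B_R ∩ {x₂ > 0}`. -/
def halfDisk (R : ℝ) : Set (ℝ × ℝ) := disk R ∩ {x | 0 < x.2}

/-- The compact set `K_δ`: two closed arcs of angular half-width `δ` on the circle of radius
`R₁`, centered at the points `(0, R₁)` and `(0, −R₁)`. -/
def crackSet (R₁ δ : ℝ) : Set (ℝ × ℝ) :=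
  {x | ∃ θ : ℝ, (θ ∈ Set.Icc (π / 2 - δ) (π / 2 + δ) ∨
      θ ∈ Set.Icc (-(π / 2) - δ) (-(π / 2) + δ)) ∧
    x = (R₁ * Real.cos θ, R₁ * Real.sin θ)}

/-- `K_δ⁺ = K_δ ∩ {x₂ > 0}`. -/
def crackSetPlus (R₁ δ : ℝ) : Set (ℝ × ℝ) := crackSet R₁ δ ∩ {x | 0 < x.2}

/-- The entire function `∑ (-t)^k / (k! (k+n)!)`, so that `J_n(z) = (z/2)^n besselSeries n (z²/4)`. -/
def besselSeries (n : ℕ) (t : ℝ) : ℝ :=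
  ∑' k : ℕ, (-1) ^ k * t ^ k / ((k.factorial : ℝ) * ((k + n).factorial : ℝ))

lemma norm_besselSeries_term_le (n k : ℕ) {t M : ℝ} (ht : |t| ≤ M) :
    ‖(-1) ^ k * t ^ k / ((k.factorial : ℝ) * ((k + n).factorial : ℝ))‖ ≤
      M ^ k / (k.factorial : ℝ) := by
  have h1 : (0 : ℝ) < k.factorial := by positivity
  have h2 : (1 : ℝ) ≤ (k + n).factorial := by exact_mod_cast (k + n).factorial_pos
  have hM : 0 ≤ M := (abs_nonneg t).trans ht
  rw [norm_div, norm_mul, norm_pow, norm_pow, norm_neg, norm_one, one_pow, one_mul,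
    Real.norm_eq_abs, Real.norm_of_nonneg (by positivity)]
  gcongr
  exact le_mul_of_one_le_right h1.le h2

lemma summable_besselSeries (n : ℕ) (t : ℝ) :
    Summable fun k : ℕ ↦ (-1) ^ k * t ^ k / ((k.factorial : ℝ) * ((k + n).factorial : ℝ)) :=
  .of_norm_bounded (Real.summable_pow_div_factorial |t|)
    fun k ↦ norm_besselSeries_term_le n k le_rfl

lemma besselSeries_deriv_term (n k : ℕ) (t : ℝ) :
    (-1) ^ (k + 1) * (((k + 1 : ℕ) : ℝ) * t ^ k) /
      (((k + 1).factorial : ℝ) * ((k + 1 + n).factorial : ℝ)) =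
    -((-1) ^ k * t ^ k / ((k.factorial : ℝ) * ((k + (n + 1)).factorial : ℝ))) := by
  have h1 : (k.factorial : ℝ) ≠ 0 := by positivity
  have h2 : ((k + (n + 1)).factorial : ℝ) ≠ 0 := by positivity
  rw [show k + 1 + n = k + (n + 1) by ring, Nat.factorial_succ k]
  push_cast
  field_simp
  ring

lemma hasDerivAt_besselSeries (n : ℕ) (t : ℝ) :
    HasDerivAt (besselSeries n) (-besselSeries (n + 1) t) t := by
  set M := |t| + 1
  have hM : t ∈ Ioo (-M) M := by
    constructor <;> simp only [M] <;> linarith [neg_abs_le t, le_abs_self t]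
  have hsplit : besselSeries n = fun s : ℝ ↦ 1 / (n.factorial : ℝ) + ∑' k : ℕ,
      (-1) ^ (k + 1) * s ^ (k + 1) / (((k + 1).factorial : ℝ) * ((k + 1 + n).factorial : ℝ)) := by
    ext s
    rw [besselSeries, (summable_besselSeries n s).tsum_eq_zero_add]
    simp
  have hterm : ∀ (k : ℕ) (y : ℝ), HasDerivAt
      (fun s : ℝ ↦ (-1) ^ (k + 1) * s ^ (k + 1) /
        (((k + 1).factorial : ℝ) * ((k + 1 + n).factorial : ℝ)))
      (-((-1) ^ k * y ^ k / ((k.factorial : ℝ) * ((k + (n + 1)).factorial : ℝ)))) y := by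
    intro k y
    rw [← besselSeries_deriv_term]
    exact ((hasDerivAt_pow (k + 1) y).const_mul ((-1) ^ (k + 1))).div_const _
  have hmain := hasDerivAt_tsum_of_isPreconnected (Real.summable_pow_div_factorial M) isOpen_Ioo
    isPreconnected_Ioo (t := Ioo (-M) M) (y₀ := t) (fun k y _ ↦ hterm k y)
    (fun k y hy ↦ by
      rw [norm_neg]
      exact norm_besselSeries_term_le (n + 1) k (abs_le.2 ⟨hy.1.le, hy.2.le⟩)) hM
    ((summable_nat_add_iff 1).2 (summable_besselSeries n t)) hM
  rw [tsum_neg] at hmain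
  rw [hsplit]
  exact hmain.const_add _

lemma contDiff_besselSeries (n : ℕ) : ContDiff ℝ (⊤ : ℕ∞) (besselSeries n) := by
  rw [contDiff_infty]
  intro m
  induction m generalizing n with
  | zero =>
    exact contDiff_zero.2 (continuous_iff_continuousAt.2
      fun t ↦ (hasDerivAt_besselSeries n t).continuousAt)
  | succ m ih =>
    push_cast
    rw [contDiff_succ_iff_deriv]
    refine ⟨fun t ↦ (hasDerivAt_besselSeries n t).differentiableAt, by simp, ?_⟩
    rw [show deriv (besselSeries n) = fun t ↦ -besselSeries (n + 1) t from
      funext fun t ↦ (hasDerivAt_besselSeries n t).deriv]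
    exact (ih (n + 1)).neg

lemma besselSeries_zero_right (n : ℕ) : besselSeries n 0 = 1 / (n.factorial : ℝ) := by
  rw [besselSeries, tsum_eq_single 0]
  · simp
  · intro k hk
    simp [hk]

/-- The three-term recurrence, equivalent to `J_n + J_{n+2} = 2(n+1)/z J_{n+1}`. -/
lemma besselSeries_recurrence (n : ℕ) (t : ℝ) :
    besselSeries n t = (n + 1) * besselSeries (n + 1) t - t * besselSeries (n + 2) t := by
  have hs := summable_besselSeries (n + 2) t
  have key : ∀ k : ℕ, (-1) ^ (k + 1) * t ^ (k + 1) /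
      (((k + 1).factorial : ℝ) * ((k + 1 + n).factorial : ℝ)) =
      (n + 1) * ((-1) ^ (k + 1) * t ^ (k + 1) /
        (((k + 1).factorial : ℝ) * ((k + 1 + (n + 1)).factorial : ℝ))) -
      t * ((-1) ^ k * t ^ k / ((k.factorial : ℝ) * ((k + (n + 2)).factorial : ℝ))) := by
    intro k
    rw [show k + (n + 2) = (k + 1 + n) + 1 by ring, show k + 1 + (n + 1) = (k + 1 + n) + 1 by ring,
      Nat.factorial_succ (k + 1 + n), Nat.factorial_succ k]
    have h1 : (k.factorial : ℝ) ≠ 0 := by positivity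
    have h2 : ((k + 1 + n).factorial : ℝ) ≠ 0 := by positivity
    push_cast
    field_simp
    ring
  have e0 := (summable_besselSeries n t).tsum_eq_zero_add
  have e1 := (summable_besselSeries (n + 1) t).tsum_eq_zero_add
  have hs1 := (summable_nat_add_iff 1).2 (summable_besselSeries (n + 1) t)
  rw [tsum_congr key, (hs1.mul_left _).tsum_sub (hs.mul_left _), tsum_mul_left, tsum_mul_left] at e0
  have h1 : (n.factorial : ℝ) ≠ 0 := by positivity
  rw [besselSeries, besselSeries, besselSeries, e0, e1]
  simp only [pow_zero, Nat.factorial_zero, zero_add, Nat.factorial_succ]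
  push_cast
  field_simp
  ring

lemma besselSeries_one_six_neg : besselSeries 1 6 < 0 := by
  have hs := summable_besselSeries 1 6
  have htail : ∀ k : ℕ, ‖(-1) ^ (k + 6) * (6 : ℝ) ^ (k + 6) /
      (((k + 6).factorial : ℝ) * ((k + 6 + 1).factorial : ℝ))‖ ≤ 1 / 50 * (1 / 2) ^ k := by
    intro k
    rw [norm_div, norm_mul, norm_pow, norm_neg, norm_one, one_pow, one_mul,
      Real.norm_of_nonneg (by positivity), Real.norm_of_nonneg (by positivity)]
    induction k with
    | zero => norm_num [Nat.factorial]
    | succ k ih =>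
      have h1 : (0 : ℝ) < (k + 6).factorial := by positivity
      have h2 : (0 : ℝ) < (k + 6 + 1).factorial := by positivity
      rw [div_le_iff₀ (by positivity)] at ih ⊢
      rw [show k + 1 + 6 = k + 6 + 1 by ring, Nat.factorial_succ (k + 6 + 1), pow_succ (6 : ℝ),
        pow_succ (1 / 2 : ℝ)]
      have h3 : ((k + 6 + 1).factorial : ℝ) = (k + 7) * ((k + 6).factorial : ℝ) := by
        rw [Nat.factorial_succ]; push_cast; ring
      set P := 1 / 50 * (1 / 2 : ℝ) ^ k * (((k + 6).factorial : ℝ) * ((k + 6 + 1).factorial : ℝ))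
      have hP : 0 < P := by positivity
      have e : 1 / 50 * ((1 / 2 : ℝ) ^ k * (1 / 2)) * (((k + 6 + 1).factorial : ℝ) *
          (((k + 6 + 1 + 1 : ℕ) : ℝ) * ((k + 6 + 1).factorial : ℝ))) =
          P * ((k + 7) * (k + 8) / 2) := by
        simp only [P]
        nth_rewrite 1 [h3]
        push_cast
        ring
      push_cast at e ⊢
      rw [e]
      have hk : (0 : ℝ) ≤ k := k.cast_nonneg
      nlinarith [mul_nonneg hP.le hk, mul_nonneg hP.le (mul_nonneg hk hk)]
  have hg : Summable fun k : ℕ ↦ 1 / 50 * (1 / 2 : ℝ) ^ k := summable_geometric_two.mul_left _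
  have htl := tsum_of_norm_bounded hg.hasSum htail
  rw [tsum_mul_left, tsum_geometric_two, Real.norm_eq_abs] at htl
  have h := hs.sum_add_tsum_nat_add 6
  rw [besselSeries, ← h]
  have hsum : ∑ i ∈ Finset.range 6, (-1) ^ i * (6 : ℝ) ^ i /
      ((i.factorial : ℝ) * ((i + 1).factorial : ℝ)) = -(7 / 50) := by
    norm_num [Finset.sum_range_succ, Nat.factorial]
  rw [hsum]
  linarith [le_abs_self (∑' k : ℕ, (-1) ^ (k + 6) * (6 : ℝ) ^ (k + 6) /
      (((k + 6).factorial : ℝ) * ((k + 6 + 1).factorial : ℝ)))]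

lemma exists_besselSeries_zeros : ∃ t₀ t₁ : ℝ, 0 < t₀ ∧ t₀ < t₁ ∧
    besselSeries 1 t₁ = 0 ∧ (∀ t ∈ Ico 0 t₁, 0 < besselSeries 1 t) ∧
    besselSeries 0 t₀ = 0 ∧ (∀ t ∈ Ico 0 t₀, 0 < besselSeries 0 t) ∧
    (∀ t ∈ Ioc t₀ t₁, besselSeries 0 t < 0) := by
  have hc : ∀ n, Continuous (besselSeries n) := fun n ↦ (contDiff_besselSeries n).continuous
  have h0 : besselSeries 1 0 = 1 := by simp [besselSeries_zero_right]
  set Z := Icc (0 : ℝ) 6 ∩ besselSeries 1 ⁻¹' {0}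
  have hZ : IsCompact Z := isCompact_Icc.inter_right (isClosed_singleton.preimage (hc 1))
  have hne : Z.Nonempty := by
    obtain ⟨z, hz, hz'⟩ := intermediate_value_Icc' (by norm_num : (0 : ℝ) ≤ 6) (hc 1).continuousOn
      (show (0 : ℝ) ∈ Icc (besselSeries 1 6) (besselSeries 1 0) from
        ⟨besselSeries_one_six_neg.le, by rw [h0]; norm_num⟩)
    exact ⟨z, hz, hz'⟩
  obtain ⟨t₁, ⟨ht₁, ht₁0⟩, hmin⟩ := hZ.exists_isLeast hne
  have ht₁0 : besselSeries 1 t₁ = 0 := ht₁0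
  have hpos₁ : 0 < t₁ := lt_of_le_of_ne ht₁.1 (by rintro rfl; rw [h0] at ht₁0; norm_num at ht₁0)
  have hb1 : ∀ t ∈ Ico 0 t₁, 0 < besselSeries 1 t := by
    intro t ht
    by_contra! hle
    obtain ⟨z, hz, hz'⟩ := intermediate_value_Icc' ht.1 (hc 1).continuousOn
      (show (0 : ℝ) ∈ Icc (besselSeries 1 t) (besselSeries 1 0) from
        ⟨hle, by rw [h0]; norm_num⟩)
    exact absurd (hmin ⟨⟨hz.1, by linarith [hz.2, ht.2, ht₁.2]⟩, hz'⟩) (by linarith [hz.2, ht.2])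
  obtain ⟨t₀, ht₀, ht₀'⟩ := exists_hasDerivAt_eq_zero (f := fun t ↦ t * besselSeries 1 t)
    (f' := besselSeries 0) hpos₁ (by fun_prop) (by simp [ht₁0]) (by
      intro t _
      have := (hasDerivAt_id t).mul (hasDerivAt_besselSeries 1 t)
      refine this.congr_deriv ?_
      rw [besselSeries_recurrence 0 t]
      simp
      ring)
  have hanti : StrictAntiOn (besselSeries 0) (Icc 0 t₁) := by
    refine strictAntiOn_of_deriv_neg (convex_Icc 0 t₁) (hc 0).continuousOn ?_
    intro t ht
    rw [interior_Icc] at ht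
    rw [(hasDerivAt_besselSeries 0 t).deriv]
    linarith [hb1 t ⟨ht.1.le, ht.2⟩]
  refine ⟨t₀, t₁, ht₀.1, ht₀.2, ht₁0, hb1, ht₀', fun t ht ↦ ?_, fun t ht ↦ ?_⟩
  · have := hanti ⟨ht.1, (ht.2.trans ht₀.2).le⟩ ⟨ht₀.1.le, ht₀.2.le⟩ ht.2
    rwa [ht₀'] at this
  · have := hanti ⟨ht₀.1.le, ht₀.2.le⟩ ⟨(ht₀.1.trans ht.1).le, ht.2⟩ ht.1
    rwa [ht₀'] at this

lemma continuousAt_sq_div_of_simple_zero {f h : ℝ → ℝ} {f' h' c : ℝ} (hf : HasDerivAt f f' c)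
    (hh : HasDerivAt h h' c) (hh' : h' ≠ 0) (hfc : f c = 0) (hhc : h c = 0) :
    ContinuousAt (fun x ↦ f x ^ 2 / h x) c := by
  rw [continuousAt_iff_punctured_nhds, hfc, hhc, div_zero]
  have h1 := hasDerivAt_iff_tendsto_slope.1 hf
  have h2 := hasDerivAt_iff_tendsto_slope.1 hh
  have h3 : Filter.Tendsto f (nhdsWithin c {c}ᶜ) (nhds 0) := by
    simpa [hfc] using hf.continuousAt.tendsto.mono_left nhdsWithin_le_nhds
  have h4 := h3.mul (h1.div h2 hh')
  rw [zero_mul] at h4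
  refine h4.congr' ?_
  filter_upwards [self_mem_nhdsWithin] with x hx
  have hx' : x - c ≠ 0 := sub_ne_zero.2 hx
  simp only [Pi.div_apply, slope_def_field, hfc, hhc, sub_zero]
  by_cases hhx : h x = 0
  · simp [hhx]
  · field_simp

/-- The sharp one-dimensional Poincaré inequality on an interval of length `π`. -/
lemma integral_sq_le_integral_deriv_sq_of_zero {f f' : ℝ → ℝ} {a : ℝ}
    (hf : ∀ x, HasDerivAt f (f' x) x) (hf' : Continuous f') (ha : f a = 0) (hb : f (a + π) = 0) :
    ∫ x in a..(a + π), f x ^ 2 ≤ ∫ x in a..(a + π), f' x ^ 2 := by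
  have hfc : Continuous f := continuous_iff_continuousAt.2 fun x ↦ (hf x).continuousAt
  have hab : a ≤ a + π := by linarith [pi_pos]
  have hsin : ∀ x, HasDerivAt (fun x ↦ sin (x - a)) (cos (x - a)) x := fun x ↦ by
    simpa using ((hasDerivAt_id x).sub_const a).sin
  have hcos : ∀ x, HasDerivAt (fun x ↦ cos (x - a)) (-sin (x - a)) x := fun x ↦ by
    simpa using ((hasDerivAt_id x).sub_const a).cos
  have hpos : ∀ x ∈ Ioo a (a + π), 0 < sin (x - a) := fun x hx ↦
    sin_pos_of_pos_of_lt_pi (by linarith [hx.1]) (by linarith [hx.2])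
  have key := intervalIntegral.sub_le_integral_of_hasDeriv_right_of_le hab
    (g := fun x ↦ cos (x - a) * (f x ^ 2 / sin (x - a)))
    (g' := fun x ↦ -sin (x - a) * (f x ^ 2 / sin (x - a)) + cos (x - a) *
      ((2 * f x * f' x * sin (x - a) - f x ^ 2 * cos (x - a)) / sin (x - a) ^ 2))
    (φ := fun x ↦ f' x ^ 2 - f x ^ 2) ?_ ?_ ?_ ?_
  · have e : ∫ x in a..(a + π), (f' x ^ 2 - f x ^ 2) =
        (∫ x in a..(a + π), f' x ^ 2) - ∫ x in a..(a + π), f x ^ 2 :=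
      intervalIntegral.integral_sub ((hf'.pow 2).intervalIntegrable _ _)
        ((hfc.pow 2).intervalIntegrable _ _)
    simp only [ha, hb, e] at key
    norm_num at key
    linarith
  · intro x hx
    refine ContinuousAt.continuousWithinAt (ContinuousAt.mul (by fun_prop) ?_)
    rcases hx.1.eq_or_lt with rfl | h1
    · exact continuousAt_sq_div_of_simple_zero (hf a) (hsin a) (by simp) ha (by simp)
    rcases hx.2.eq_or_lt with rfl | h2
    · exact continuousAt_sq_div_of_simple_zero (hf _) (hsin _) (by simp) hb (by simp)
    · exact ((hfc.pow 2).continuousAt).div (by fun_prop) (hpos x ⟨h1, h2⟩).ne'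
  · intro x hx
    have := (hcos x).mul (((hf x).pow 2).div (hsin x) (hpos x hx).ne')
    refine (this.congr_deriv ?_).hasDerivWithinAt
    simp
  · exact ((hf'.pow 2).sub (hfc.pow 2)).integrableOn_Icc
  · intro x hx
    have hs := hpos x hx
    have e : -sin (x - a) * (f x ^ 2 / sin (x - a)) + cos (x - a) *
        ((2 * f x * f' x * sin (x - a) - f x ^ 2 * cos (x - a)) / sin (x - a) ^ 2) =
        f' x ^ 2 - f x ^ 2 - (f' x - f x * cos (x - a) / sin (x - a)) ^ 2 := by
      field_simp
      ring
    rw [e]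
    nlinarith [sq_nonneg (f' x - f x * cos (x - a) / sin (x - a))]

/-- **Wirtinger's inequality** for `2π`-periodic functions of mean zero. -/
lemma wirtinger_inequality {f f' : ℝ → ℝ} (hf : ∀ x, HasDerivAt f (f' x) x)
    (hf' : Continuous f') (hper : Function.Periodic f (2 * π)) (hper' : Function.Periodic f' (2 * π))
    (hmean : ∫ x in -π..π, f x = 0) :
    ∫ x in -π..π, f x ^ 2 ≤ ∫ x in -π..π, f' x ^ 2 := by
  have hfc : Continuous f := continuous_iff_continuousAt.2 fun x ↦ (hf x).continuousAt
  obtain ⟨a, ha⟩ : ∃ a, f a = f (a + π) := by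
    have hd : Continuous fun x ↦ f x - f (x + π) := by fun_prop
    have h2 : f (π + π) = f 0 := by
      have := hper 0
      rwa [zero_add, two_mul] at this
    obtain ⟨a, -, ha⟩ : ∃ a ∈ uIcc 0 π, f a - f (a + π) = 0 := by
      refine intermediate_value_uIcc hd.continuousOn ?_
      rw [h2, zero_add, mem_uIcc]
      rcases le_total (f 0) (f π) with h | h
      · exact Or.inl ⟨by linarith, by linarith⟩
      · exact Or.inr ⟨by linarith, by linarith⟩
    exact ⟨a, sub_eq_zero.1 ha⟩
  have hshift : ∀ g : ℝ → ℝ, Function.Periodic g (2 * π) →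
      ∫ x in -π..π, g x = ∫ x in a..(a + 2 * π), g x := fun g hg ↦ by
    rw [← hg.intervalIntegral_add_eq (-π) a]
    congr 1
    ring
  have hg : ∀ x, HasDerivAt (fun x ↦ f x - f a) (f' x) x := fun x ↦ (hf x).sub_const _
  have h1 := integral_sq_le_integral_deriv_sq_of_zero hg hf' (a := a) (by simp) (by simp [ha])
  have h2 := integral_sq_le_integral_deriv_sq_of_zero hg hf' (a := a + π) (by simp [ha]) (by
    rw [show a + π + π = a + 2 * π by ring, hper a, sub_self])
  have hsplit : ∀ (g : ℝ → ℝ), Continuous g → (∫ x in a..(a + π), g x) +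
      ∫ x in (a + π)..(a + π + π), g x = ∫ x in a..(a + 2 * π), g x := fun g hgc ↦ by
    rw [intervalIntegral.integral_add_adjacent_intervals (hgc.intervalIntegrable _ _)
      (hgc.intervalIntegrable _ _)]
    congr 1
    ring
  have h3 := hsplit (fun x ↦ (f x - f a) ^ 2) (by fun_prop)
  have h4 := hsplit (fun x ↦ f' x ^ 2) (by fun_prop)
  have hmean' := hmean
  rw [hshift f hper] at hmean'
  rw [hshift _ (fun x ↦ by simp only [hper x]), hshift (fun x ↦ f' x ^ 2) (fun x ↦ by
    simp only [hper' x])]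
  have hexp : ∫ x in a..(a + 2 * π), (f x - f a) ^ 2 =
      (∫ x in a..(a + 2 * π), f x ^ 2) + 2 * π * f a ^ 2 := by
    have e : ∀ x, (f x - f a) ^ 2 = f x ^ 2 - (2 * f a) * f x + f a ^ 2 := fun x ↦ by ring
    simp_rw [e]
    rw [intervalIntegral.integral_add, intervalIntegral.integral_sub,
      intervalIntegral.integral_const_mul, hmean', intervalIntegral.integral_const]
    · simp
    all_goals exact Continuous.intervalIntegrable (by fun_prop) _ _
  nlinarith [mul_nonneg pi_pos.le (sq_nonneg (f a))]

lemma hasDerivAt_besselSeries_scaled (n : ℕ) (κ r : ℝ) :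
    HasDerivAt (fun r ↦ besselSeries n (κ * r ^ 2))
      (-(2 * κ * r * besselSeries (n + 1) (κ * r ^ 2))) r := by
  have h1 : HasDerivAt (fun r : ℝ ↦ κ * r ^ 2) (κ * (2 * r)) r := by
    simpa using (hasDerivAt_pow 2 r).const_mul κ
  refine ((hasDerivAt_besselSeries n (κ * r ^ 2)).comp r h1).congr_deriv ?_
  ring

/-- Picone's inequality against the radial solution `J₀`, on an interval where it has no zero. -/
lemma picone_besselSeries_zero {κ a b : ℝ} (ha : 0 ≤ a) (hab : a ≤ b) {m m' : ℝ → ℝ}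
    (hm : ∀ r, HasDerivAt m (m' r) r) (hm' : Continuous m')
    (hpos : ∀ r ∈ Ioo a b, besselSeries 0 (κ * r ^ 2) ≠ 0)
    (hcont : ∀ r ∈ Icc a b, ContinuousAt (fun r ↦ m r ^ 2 / besselSeries 0 (κ * r ^ 2)) r)
    (hza : a = 0 ∨ m a = 0) (hzb : m b = 0) :
    4 * κ * ∫ r in a..b, r * m r ^ 2 ≤ ∫ r in a..b, r * m' r ^ 2 := by
  have hmc : Continuous m := continuous_iff_continuousAt.2 fun x ↦ (hm x).continuousAt
  have hbc : Continuous (besselSeries 1) := (contDiff_besselSeries 1).continuous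
  have hc : ∀ r : ℝ, HasDerivAt (fun r : ℝ ↦ r ^ 2) (2 * r) r := fun r ↦ by
    simpa using hasDerivAt_pow 2 r
  have key := intervalIntegral.sub_le_integral_of_hasDeriv_right_of_le hab
    (g := fun r ↦ -(2 * κ) * (r ^ 2 * besselSeries 1 (κ * r ^ 2)) *
      (m r ^ 2 / besselSeries 0 (κ * r ^ 2)))
    (φ := fun r ↦ r * m' r ^ 2 - 4 * κ * (r * m r ^ 2))
    (ContinuousOn.mul (by fun_prop) fun r hr ↦ (hcont r hr).continuousWithinAt)
    (fun r hr ↦ ((((hc r).mul (hasDerivAt_besselSeries_scaled 1 κ r)).const_mul (-(2 * κ))).mul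
      (((hm r).pow 2).div (hasDerivAt_besselSeries_scaled 0 κ r) (hpos r hr))).hasDerivWithinAt)
    (Continuous.integrableOn_Icc (by fun_prop)) ?_
  · rw [intervalIntegral.integral_sub (Continuous.intervalIntegrable (by fun_prop) _ _)
      (Continuous.intervalIntegrable (by fun_prop) _ _), intervalIntegral.integral_const_mul] at key
    rcases hza with rfl | hza
    · simp only [hzb] at key
      norm_num at key
      exact key
    · simp only [hza, hzb] at key
      norm_num at key
      exact key
  · intro r hr
    have hr0 : 0 < r := ha.trans_lt hr.1
    have hP := hpos r hr
    have hrec := besselSeries_recurrence 0 (κ * r ^ 2)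
    simp only [Nat.cast_zero, zero_add, one_mul] at hrec
    simp only [zero_add, Pi.mul_apply, Pi.pow_apply, Pi.div_apply]
    set P := besselSeries 0 (κ * r ^ 2)
    set Q := besselSeries 1 (κ * r ^ 2)
    have hS : κ * r ^ 2 * besselSeries (1 + 1) (κ * r ^ 2) = Q - P := by
      rw [one_add_one_eq_two]; linarith
    have e : r ^ 2 * -(2 * κ * r * besselSeries (1 + 1) (κ * r ^ 2)) = -(2 * r) * (Q - P) := by
      rw [← hS]; ring
    rw [e, show r * m' r ^ 2 - 4 * κ * (r * m r ^ 2) =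
      r * (m' r + 2 * κ * r * Q * m r / P) ^ 2 + (-(2 * κ) * (2 * r * Q + -(2 * r) * (Q - P)) *
      (m r ^ 2 / P) + -(2 * κ) * (r ^ 2 * Q) * ((2 * m r ^ (2 - 1) * m' r * P -
      m r ^ 2 * -(2 * κ * r * Q)) / P ^ 2)) by field_simp; ring]
    have : 0 ≤ r * (m' r + 2 * κ * r * Q * m r / P) ^ 2 := by positivity
    push_cast
    linarith

/-- A radial profile vanishing at the node `r₀` of `J₀` satisfies the sharp weighted Poincaré
inequality. -/
lemma radial_poincare {κ t₀ t₁ r₀ ρ : ℝ} (hκ : 0 < κ) (hr₀ : 0 < r₀) (hρ : r₀ < ρ)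
    (h₀ : κ * r₀ ^ 2 = t₀) (h₁ : κ * ρ ^ 2 ≤ t₁) (hb1 : ∀ t ∈ Ico 0 t₁, 0 < besselSeries 1 t)
    (hz : besselSeries 0 t₀ = 0) (hb0 : ∀ t ∈ Ico 0 t₀, 0 < besselSeries 0 t)
    (hb0' : ∀ t ∈ Ioc t₀ t₁, besselSeries 0 t < 0) {m m' : ℝ → ℝ}
    (hm : ∀ r, HasDerivAt m (m' r) r) (hm' : Continuous m') (hm₀ : m r₀ = 0) (hmρ : m ρ = 0) :
    4 * κ * ∫ r in 0..ρ, r * m r ^ 2 ≤ ∫ r in 0..ρ, r * m' r ^ 2 := by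
  have hmc : Continuous m := continuous_iff_continuousAt.2 fun x ↦ (hm x).continuousAt
  have hbc : Continuous (besselSeries 0) := (contDiff_besselSeries 0).continuous
  have hlt : ∀ r, 0 ≤ r → r < r₀ → 0 < besselSeries 0 (κ * r ^ 2) := fun r h h' ↦
    hb0 _ ⟨by positivity, by rw [← h₀]; gcongr⟩
  have hgt : ∀ r, r₀ < r → r ≤ ρ → besselSeries 0 (κ * r ^ 2) < 0 := fun r h h' ↦
    hb0' _ ⟨by rw [← h₀]; gcongr, le_trans (by have := hr₀.trans h; gcongr) h₁⟩
  have hr₀b : 0 < besselSeries 1 (κ * r₀ ^ 2) :=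
    hb1 _ ⟨by positivity, lt_of_lt_of_le (by gcongr) h₁⟩
  have hne : ∀ r, 0 ≤ r → r ≤ ρ → r ≠ r₀ → besselSeries 0 (κ * r ^ 2) ≠ 0 := by
    intro r h h' hn
    rcases hn.lt_or_gt with hn | hn
    · exact (hlt r h hn).ne'
    · exact (hgt r hn h').ne
  have hcont : ∀ r, 0 ≤ r → r ≤ ρ →
      ContinuousAt (fun r ↦ m r ^ 2 / besselSeries 0 (κ * r ^ 2)) r := by
    intro r h h'
    by_cases hn : r = r₀
    · rw [hn]
      refine continuousAt_sq_div_of_simple_zero (hm r₀) (hasDerivAt_besselSeries_scaled 0 κ r₀) ?_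
        hm₀ (by rw [h₀, hz])
      simpa using ⟨⟨hκ.ne', hr₀.ne'⟩, hr₀b.ne'⟩
    · exact (hmc.pow 2).continuousAt.div (by fun_prop) (hne r h h' hn)
  have i1 := picone_besselSeries_zero (κ := κ) le_rfl hr₀.le hm hm'
    (fun r hr ↦ hne r hr.1.le (by linarith [hr.2]) hr.2.ne)
    (fun r hr ↦ hcont r hr.1 (by linarith [hr.2])) (Or.inl rfl) hm₀
  have i2 := picone_besselSeries_zero (κ := κ) hr₀.le hρ.le hm hm'
    (fun r hr ↦ hne r (by linarith [hr.1]) hr.2.le hr.1.ne')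
    (fun r hr ↦ hcont r (by linarith [hr.1]) hr.2) (Or.inr hm₀) hmρ
  have hsplit : ∀ g : ℝ → ℝ, Continuous g →
      ∫ r in 0..ρ, g r = (∫ r in 0..r₀, g r) + ∫ r in r₀..ρ, g r := fun g hg ↦
    (intervalIntegral.integral_add_adjacent_intervals (hg.intervalIntegrable _ _)
      (hg.intervalIntegrable _ _)).symm
  rw [hsplit (fun r ↦ r * m r ^ 2) (by fun_prop), hsplit (fun r ↦ r * m' r ^ 2) (by fun_prop)]
  linarith

/-- Picone's inequality against the first angular solution `J₁`: here `W`, `D`, `T` play the roles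
of the integrals over circles of `w²`, `(∂_r w)²` and `(∂_θ w / r)²`. -/
lemma angular_poincare {κ t₁ ρ : ℝ} (hκ : 0 < κ) (hρ : 0 ≤ ρ) (h₁ : κ * ρ ^ 2 < t₁)
    (hb1 : ∀ t ∈ Ico 0 t₁, 0 < besselSeries 1 t) {W W' D T : ℝ → ℝ}
    (hW : ∀ r, HasDerivAt W (W' r) r) (hD : Continuous D) (hT : Continuous T)
    (hW0 : W 0 = 0) (hWρ : W ρ = 0) (hcs : ∀ r c, c * W' r ≤ c ^ 2 * W r + D r)
    (hwir : ∀ r, W r ≤ r ^ 2 * T r) :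
    4 * κ * ∫ r in 0..ρ, r * W r ≤ ∫ r in 0..ρ, r * (D r + T r) := by
  have hWc : Continuous W := continuous_iff_continuousAt.2 fun x ↦ (hW x).continuousAt
  have hbc : ∀ n, Continuous (besselSeries n) := fun n ↦ (contDiff_besselSeries n).continuous
  have hpos : ∀ r ∈ Icc 0 ρ, 0 < besselSeries 1 (κ * r ^ 2) := fun r hr ↦
    hb1 _ ⟨by positivity, lt_of_le_of_lt (by have := hr.1; have := hr.2; gcongr) h₁⟩
  have hc : ∀ r : ℝ, HasDerivAt (fun r : ℝ ↦ r ^ 2) (2 * r) r := fun r ↦ by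
    simpa using hasDerivAt_pow 2 r
  have key := intervalIntegral.sub_le_integral_of_hasDeriv_right_of_le hρ
    (g := fun r ↦ (1 - 2 * κ * (r ^ 2 * besselSeries 2 (κ * r ^ 2) /
      besselSeries 1 (κ * r ^ 2))) * W r)
    (φ := fun r ↦ r * (D r + T r) - 4 * κ * (r * W r))
    (ContinuousOn.mul (continuousOn_const.sub (continuousOn_const.mul
      (ContinuousOn.div (by fun_prop) (by fun_prop) fun r hr ↦ (hpos r hr).ne'))) (by fun_prop))
    (fun r hr ↦ ((((((hc r).mul (hasDerivAt_besselSeries_scaled 2 κ r)).div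
      (hasDerivAt_besselSeries_scaled 1 κ r) (hpos r ⟨hr.1.le, hr.2.le⟩).ne').const_mul
      (2 * κ)).const_sub 1).mul (hW r)).hasDerivWithinAt)
    (Continuous.integrableOn_Icc (by fun_prop)) ?_
  · rw [intervalIntegral.integral_sub (Continuous.intervalIntegrable (by fun_prop) _ _)
      (Continuous.intervalIntegrable (by fun_prop) _ _), intervalIntegral.integral_const_mul] at key
    simp only [hW0, hWρ] at key
    norm_num at key
    exact key
  · intro r hr
    have hr0 : 0 < r := hr.1
    have hP := hpos r ⟨hr.1.le, hr.2.le⟩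
    have hrec := besselSeries_recurrence 1 (κ * r ^ 2)
    norm_num at hrec
    simp only [Pi.mul_apply, Pi.div_apply]
    rw [show (2 + 1 : ℕ) = 3 from rfl, show (1 + 1 : ℕ) = 2 from rfl]
    set P := besselSeries 1 (κ * r ^ 2)
    set Q := besselSeries 2 (κ * r ^ 2)
    have hS : κ * r ^ 2 * besselSeries 3 (κ * r ^ 2) = 2 * Q - P := by linarith
    have e : r ^ 2 * -(2 * κ * r * besselSeries 3 (κ * r ^ 2)) = -(2 * r) * (2 * Q - P) := by
      rw [← hS]; ring
    set ψ := 1 - 2 * κ * (r ^ 2 * Q / P) with hψ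
    have e2 : -(2 * κ * (((2 * r * Q + -(2 * r) * (2 * Q - P)) * P -
        r ^ 2 * Q * -(2 * κ * r * Q)) / P ^ 2)) = (1 - ψ ^ 2) / r - 4 * κ * r := by
      rw [hψ]
      field_simp
      ring
    rw [e, e2]
    have h1 := mul_le_mul_of_nonneg_left (hcs r (ψ / r)) hr0.le
    have h2 : r * (ψ / r * W' r) = ψ * W' r := by field_simp
    have h3 : r * ((ψ / r) ^ 2 * W r + D r) = ψ ^ 2 / r * W r + r * D r := by field_simp
    have h4 : W r / r ≤ r * T r := by
      rw [div_le_iff₀ hr0]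
      nlinarith [hwir r]
    have h5 : ((1 - ψ ^ 2) / r - 4 * κ * r) * W r =
      W r / r - ψ ^ 2 / r * W r - 4 * κ * (r * W r) := by field_simp
    rw [h2, h3] at h1
    rw [h5]
    linarith

lemma hasDerivAt_integral_of_continuous_deriv {F F' : ℝ → ℝ → ℝ} {a b : ℝ}
    (hF : Continuous (Function.uncurry F)) (hF' : Continuous (Function.uncurry F'))
    (hd : ∀ r θ, HasDerivAt (fun r ↦ F r θ) (F' r θ) r) (r : ℝ) :
    HasDerivAt (fun r ↦ ∫ θ in a..b, F r θ) (∫ θ in a..b, F' r θ) r := by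
  obtain ⟨C, hC⟩ := (isCompact_Icc (a := r - 1) (b := r + 1)).prod (isCompact_uIcc (a := a) (b := b))
    |>.exists_bound_of_continuousOn hF'.continuousOn
  have hFr : ∀ r, Continuous (F r) := fun r ↦ hF.comp (by fun_prop : Continuous fun θ ↦ (r, θ))
  have hFr' : ∀ r, Continuous (F' r) := fun r ↦ hF'.comp (by fun_prop : Continuous fun θ ↦ (r, θ))
  refine (intervalIntegral.hasDerivAt_integral_of_dominated_loc_of_deriv_le
    (bound := fun _ ↦ C) (Icc_mem_nhds (by linarith : r - 1 < r) (by linarith : r < r + 1))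
    (Filter.Eventually.of_forall fun x ↦ (hFr x).aestronglyMeasurable)
    ((hFr r).intervalIntegrable _ _) (hFr' r).aestronglyMeasurable
    (Filter.Eventually.of_forall fun θ hθ x hx ↦ hC (x, θ) ⟨hx, uIoc_subset_uIcc hθ⟩)
    (by simp) (Filter.Eventually.of_forall fun θ _ x _ ↦ hd x θ)).2

lemma integral_eq_polar {f : ℝ × ℝ → ℝ} (hf : Continuous f) {ρ : ℝ} (hρ : 0 ≤ ρ)
    (hz : ∀ x : ℝ × ℝ, ρ ^ 2 ≤ x.1 ^ 2 + x.2 ^ 2 → f x = 0) :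
    ∫ x, f x = ∫ r in 0..ρ, r * ∫ θ in -π..π, f (r * cos θ, r * sin θ) := by
  have hc : Continuous fun p : ℝ × ℝ ↦ p.1 • f (p.1 * cos p.2, p.1 * sin p.2) := by fun_prop
  have h1 : ∫ p in polarCoord.target, p.1 • f (polarCoord.symm p) =
      ∫ p in Ioc 0 ρ ×ˢ Ioo (-π) π, p.1 • f (p.1 * cos p.2, p.1 * sin p.2) := by
    refine (setIntegral_eq_of_subset_of_forall_sdiff_eq_zero
      (measurableSet_Ioi.prod measurableSet_Ioo)
      (prod_mono Ioc_subset_Ioi_self Subset.rfl) ?_)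
    rintro ⟨r, θ⟩ ⟨⟨hr, hθ⟩, hn⟩
    have hr' : ρ < r := by
      by_contra! hle
      exact hn ⟨⟨hr, hle⟩, hθ⟩
    have : f (r * cos θ, r * sin θ) = 0 := by
      apply hz
      have : (r * cos θ) ^ 2 + (r * sin θ) ^ 2 = r ^ 2 := by
        nlinarith [sin_sq_add_cos_sq θ]
      simp only [this]
      gcongr
    simp [this]
  rw [← integral_comp_polarCoord_symm, h1, Measure.volume_eq_prod, setIntegral_prod,
    intervalIntegral.integral_of_le hρ]
  · congr 1
    ext r
    rw [intervalIntegral.integral_of_le (by linarith [pi_pos]), integral_Ioc_eq_integral_Ioo,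
      ← integral_const_mul]
    rfl
  · exact (hc.continuousOn.integrableOn_compact (isCompact_Icc.prod isCompact_Icc)).mono_set
      (prod_mono Ioc_subset_Icc_self Ioo_subset_Icc_self)

lemma clm_apply_prod (L : ℝ × ℝ →L[ℝ] ℝ) (a b : ℝ) :
    L (a, b) = a * L (1, 0) + b * L (0, 1) := by
  rw [show ((a, b) : ℝ × ℝ) = a • (1, 0) + b • (0, 1) by simp, map_add, map_smul, map_smul]
  rfl

/-- A function supported in the disk whose mean over the nodal circle of `J₀` vanishes has
Rayleigh quotient at least `4 t₁ / R²`. -/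
lemma rayleigh_lower_bound {κ t₀ t₁ r₀ ρ : ℝ} (hκ : 0 < κ) (hr₀ : 0 < r₀) (hρ : r₀ < ρ)
    (h₀ : κ * r₀ ^ 2 = t₀) (h₁ : κ * ρ ^ 2 < t₁) (hb1 : ∀ t ∈ Ico 0 t₁, 0 < besselSeries 1 t)
    (hz : besselSeries 0 t₀ = 0) (hb0 : ∀ t ∈ Ico 0 t₀, 0 < besselSeries 0 t)
    (hb0' : ∀ t ∈ Ioc t₀ t₁, besselSeries 0 t < 0) {u : ℝ × ℝ → ℝ}
    (hu : ContDiff ℝ (⊤ : ℕ∞) u) (hsupp : tsupport u ⊆ disk ρ)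
    (hmean : ∫ θ in -π..π, u (r₀ * cos θ, r₀ * sin θ) = 0) :
    4 * κ * ∫ x, u x ^ 2 ≤ ∫ x, gradSq u x := by
  have hρ0 : 0 < ρ := hr₀.trans hρ
  have huc : Continuous u := hu.continuous
  have hud : Differentiable ℝ u := hu.differentiable (by simp)
  have hfc : Continuous (fderiv ℝ u) := hu.continuous_fderiv (by simp)
  set ux : ℝ × ℝ → ℝ := fun x ↦ fderiv ℝ u x (1, 0) with hux
  set uy : ℝ × ℝ → ℝ := fun x ↦ fderiv ℝ u x (0, 1) with huy
  have huxc : Continuous ux := by fun_prop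
  have huyc : Continuous uy := by fun_prop
  have hout : ∀ x : ℝ × ℝ, ρ ^ 2 ≤ x.1 ^ 2 + x.2 ^ 2 → x ∉ tsupport u :=
    fun x hx h ↦ not_lt.2 hx (hsupp h)
  have hu0 : ∀ x : ℝ × ℝ, ρ ^ 2 ≤ x.1 ^ 2 + x.2 ^ 2 → u x = 0 :=
    fun x hx ↦ image_eq_zero_of_notMem_tsupport (hout x hx)
  have hg0 : ∀ x : ℝ × ℝ, ρ ^ 2 ≤ x.1 ^ 2 + x.2 ^ 2 → gradSq u x = 0 := fun x hx ↦ by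
    simp [gradSq, fderiv_of_notMem_tsupport (𝕜 := ℝ) (hout x hx)]
  set U : ℝ → ℝ → ℝ := fun r θ ↦ u (r * cos θ, r * sin θ) with hU
  set A : ℝ → ℝ → ℝ := fun r θ ↦
    cos θ * ux (r * cos θ, r * sin θ) + sin θ * uy (r * cos θ, r * sin θ) with hA
  set B : ℝ → ℝ → ℝ := fun r θ ↦
    -sin θ * ux (r * cos θ, r * sin θ) + cos θ * uy (r * cos θ, r * sin θ) with hB
  have hUc : Continuous (Function.uncurry U) := by simp only [hU, Function.uncurry_def]; fun_prop
  have hAc : Continuous (Function.uncurry A) := by simp only [hA, Function.uncurry_def]; fun_prop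
  have hBc : Continuous (Function.uncurry B) := by simp only [hB, Function.uncurry_def]; fun_prop
  have hUr : ∀ r, Continuous (U r) := fun r ↦ by simp only [hU]; fun_prop
  have hAr : ∀ r, Continuous (A r) := fun r ↦ by simp only [hA]; fun_prop
  have hBr : ∀ r, Continuous (B r) := fun r ↦ by simp only [hB]; fun_prop
  have hUA : ∀ r θ, HasDerivAt (fun r ↦ U r θ) (A r θ) r := fun r θ ↦ by
    have h1 : HasDerivAt (fun r : ℝ ↦ (r * cos θ, r * sin θ)) (cos θ, sin θ) r := by
      simpa using ((hasDerivAt_id r).mul_const (cos θ)).prodMk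
        ((hasDerivAt_id r).mul_const (sin θ))
    refine ((hud _).hasFDerivAt.comp_hasDerivAt r h1).congr_deriv ?_
    rw [clm_apply_prod]
  have hUB : ∀ r θ, HasDerivAt (U r) (r * B r θ) θ := fun r θ ↦ by
    have h1 : HasDerivAt (fun θ : ℝ ↦ (r * cos θ, r * sin θ)) (r * -sin θ, r * cos θ) θ :=
      ((hasDerivAt_cos θ).const_mul r).prodMk ((hasDerivAt_sin θ).const_mul r)
    refine ((hud _).hasFDerivAt.comp_hasDerivAt θ h1).congr_deriv ?_
    rw [clm_apply_prod]
    simp only [hB]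
    ring
  set m : ℝ → ℝ := fun r ↦ (2 * π)⁻¹ * ∫ θ in -π..π, U r θ with hm
  set m' : ℝ → ℝ := fun r ↦ (2 * π)⁻¹ * ∫ θ in -π..π, A r θ with hm'
  have hmd : ∀ r, HasDerivAt m (m' r) r := fun r ↦
    (hasDerivAt_integral_of_continuous_deriv hUc hAc hUA r).const_mul _
  have hmc : Continuous m := continuous_iff_continuousAt.2 fun x ↦ (hmd x).continuousAt
  have hmc' : Continuous m' := continuous_const.mul
    (intervalIntegral.continuous_parametric_intervalIntegral_of_continuous' hAc _ _)
  have hmU : ∀ r, ∫ θ in -π..π, U r θ = 2 * π * m r := fun r ↦ by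
    simp only [hm]; field_simp
  have hmA : ∀ r, ∫ θ in -π..π, A r θ = 2 * π * m' r := fun r ↦ by
    simp only [hm']; field_simp
  have hvar : ∀ (f : ℝ → ℝ) (c : ℝ), Continuous f → ∫ θ in -π..π, f θ = 2 * π * c →
      ∫ θ in -π..π, f θ ^ 2 = (∫ θ in -π..π, (f θ - c) ^ 2) + 2 * π * c ^ 2 := by
    intro f c hf hfc
    have e : ∀ θ, (f θ - c) ^ 2 = f θ ^ 2 - (2 * c) * f θ + c ^ 2 := fun θ ↦ by ring
    simp_rw [e]
    rw [intervalIntegral.integral_add, intervalIntegral.integral_sub,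
      intervalIntegral.integral_const_mul, hfc, intervalIntegral.integral_const]
    · simp only [smul_eq_mul]; ring
    all_goals exact Continuous.intervalIntegrable (by fun_prop) _ _
  set W : ℝ → ℝ := fun r ↦ ∫ θ in -π..π, (U r θ - m r) ^ 2 with hW
  set W' : ℝ → ℝ := fun r ↦ ∫ θ in -π..π, 2 * (U r θ - m r) * (A r θ - m' r) with hW'
  set D : ℝ → ℝ := fun r ↦ ∫ θ in -π..π, (A r θ - m' r) ^ 2 with hD
  set T : ℝ → ℝ := fun r ↦ ∫ θ in -π..π, B r θ ^ 2 with hT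
  have hwc : Continuous fun p : ℝ × ℝ ↦ U p.1 p.2 - m p.1 :=
    hUc.sub (hmc.comp continuous_fst)
  have hac : Continuous fun p : ℝ × ℝ ↦ A p.1 p.2 - m' p.1 :=
    hAc.sub (hmc'.comp continuous_fst)
  have hWd : ∀ r, HasDerivAt W (W' r) r := by
    refine hasDerivAt_integral_of_continuous_deriv (F := fun r θ ↦ (U r θ - m r) ^ 2)
      (F' := fun r θ ↦ 2 * (U r θ - m r) * (A r θ - m' r)) (hwc.pow 2)
      ((continuous_const.mul hwc).mul hac) ?_
    intro r θ
    refine (((hUA r θ).sub (hmd r)).pow 2).congr_deriv ?_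
    simp
  have hDc : Continuous D :=
    intervalIntegral.continuous_parametric_intervalIntegral_of_continuous' (hac.pow 2) _ _
  have hTc : Continuous T :=
    intervalIntegral.continuous_parametric_intervalIntegral_of_continuous' (hBc.pow 2) _ _
  have hWc : Continuous W := continuous_iff_continuousAt.2 fun x ↦ (hWd x).continuousAt
  have hmr₀ : m r₀ = 0 := by simp only [hm, hU, hmean, mul_zero]
  have hUρ : ∀ θ, U ρ θ = 0 := fun θ ↦ hu0 _ (by
    simp only; nlinarith [sin_sq_add_cos_sq θ])
  have hmρ : m ρ = 0 := by simp [hm, hUρ]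
  have hU00 : ∀ θ, U 0 θ = u (0, 0) := fun θ ↦ by simp [hU]
  have hm00 : m 0 = u (0, 0) := by
    simp only [hm, hU00, intervalIntegral.integral_const, smul_eq_mul]
    field_simp
    ring
  have hpi : -π ≤ π := by linarith [pi_pos]
  have hcs : ∀ r c, c * W' r ≤ c ^ 2 * W r + D r := by
    intro r c
    simp only [hW, hW', hD]
    have hr := hUr r
    have hr' := hAr r
    rw [← intervalIntegral.integral_const_mul, ← intervalIntegral.integral_const_mul,
      ← intervalIntegral.integral_add (Continuous.intervalIntegrable (by fun_prop) _ _)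
        (Continuous.intervalIntegrable (by fun_prop) _ _)]
    refine intervalIntegral.integral_mono hpi (Continuous.intervalIntegrable (by fun_prop) _ _)
        (Continuous.intervalIntegrable (by fun_prop) _ _) fun θ ↦ ?_
    simp only
    nlinarith [sq_nonneg (c * (U r θ - m r) - (A r θ - m' r))]
  have hwir : ∀ r, W r ≤ r ^ 2 * T r := by
    intro r
    have hr := hUr r
    have hr' := hBr r
    have := wirtinger_inequality (f := fun θ ↦ U r θ - m r) (f' := fun θ ↦ r * B r θ)
      (fun θ ↦ (hUB r θ).sub_const _) (by fun_prop) (fun θ ↦ by simp [hU])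
      (fun θ ↦ by simp [hB]) (by
        rw [intervalIntegral.integral_sub (hr.intervalIntegrable _ _)
          (Continuous.intervalIntegrable (by fun_prop) _ _), hmU, intervalIntegral.integral_const]
        simp only [smul_eq_mul]; ring)
    simp only [mul_pow, intervalIntegral.integral_const_mul] at this
    exact this
  have i1 := radial_poincare hκ hr₀ hρ h₀ h₁.le hb1 hz hb0 hb0' hmd hmc' hmr₀ hmρ
  have i2 := angular_poincare hκ hρ0.le h₁ hb1 hWd hDc hTc (by simp [hW, hU00, hm00])
    (by simp [hW, hUρ, hmρ]) hcs hwir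
  have hgc : Continuous (gradSq u) := by unfold gradSq; fun_prop
  rw [integral_eq_polar (f := fun x ↦ u x ^ 2) (huc.pow 2) hρ0.le
      (fun x hx ↦ by simp [hu0 x hx]),
    integral_eq_polar hgc hρ0.le hg0]
  have e1 : ∀ r, r * ∫ θ in -π..π, u (r * cos θ, r * sin θ) ^ 2 =
      r * W r + 2 * π * (r * m r ^ 2) := fun r ↦ by
    rw [hvar _ _ (hUr r) (hmU r)]; ring
  have e2 : ∀ r, r * ∫ θ in -π..π, gradSq u (r * cos θ, r * sin θ) =
      r * (D r + T r) + 2 * π * (r * m' r ^ 2) := fun r ↦ by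
    have e : ∀ θ, gradSq u (r * cos θ, r * sin θ) = A r θ ^ 2 + B r θ ^ 2 := fun θ ↦ by
      simp only [gradSq, hA, hB, hux, huy]
      linear_combination (-(fderiv ℝ u (r * cos θ, r * sin θ) (1, 0)) ^ 2 -
        (fderiv ℝ u (r * cos θ, r * sin θ) (0, 1)) ^ 2) * sin_sq_add_cos_sq θ
    simp_rw [e]
    rw [intervalIntegral.integral_add
      (Continuous.intervalIntegrable (by have := hAr r; fun_prop) _ _)
      (Continuous.intervalIntegrable (by have := hBr r; fun_prop) _ _), hvar _ _ (hAr r) (hmA r)]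
    ring
  simp only [e1, e2]
  rw [intervalIntegral.integral_add (Continuous.intervalIntegrable (by fun_prop) _ _)
      (Continuous.intervalIntegrable (by fun_prop) _ _), intervalIntegral.integral_add
      (Continuous.intervalIntegrable (by fun_prop) _ _)
      (Continuous.intervalIntegrable (by fun_prop) _ _), intervalIntegral.integral_const_mul,
      intervalIntegral.integral_const_mul]
  nlinarith [mul_le_mul_of_nonneg_left i1 (by positivity : 0 ≤ 2 * π)]

namespace testFun

variable {ω : Set (ℝ × ℝ)} {u v : ℝ × ℝ → ℝ}

lemma differentiable (hu : testFun ω u) : Differentiable ℝ u := hu.1.differentiable (by simp)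

lemma continuous (hu : testFun ω u) : Continuous u := hu.1.continuous

lemma mono {ω' : Set (ℝ × ℝ)} (h : ω ⊆ ω') (hu : testFun ω u) : testFun ω' u :=
  ⟨hu.1, hu.2.1, hu.2.2.trans h⟩

lemma linear_comb (hu : testFun ω u) (hv : testFun ω v) (a b : ℝ) :
    testFun ω (a • u + b • v) := by
  have hK : Function.support (a • u + b • v) ⊆ tsupport u ∪ tsupport v := fun x hx ↦ by
    by_contra! h
    rw [mem_union, not_or] at h
    exact hx (by simp [image_eq_zero_of_notMem_tsupport h.1, image_eq_zero_of_notMem_tsupport h.2])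
  refine ⟨(hu.1.const_smul a).add (hv.1.const_smul b), ?_, ?_⟩
  · exact HasCompactSupport.of_support_subset_isCompact (hu.2.1.union hv.2.1) hK
  · exact (closure_minimal hK ((isClosed_tsupport u).union (isClosed_tsupport v))).trans
      (union_subset hu.2.2 hv.2.2)

lemma hasCompactSupport_sq (hu : testFun ω u) : HasCompactSupport fun x ↦ u x ^ 2 :=
  HasCompactSupport.intro hu.2.1 fun x hx ↦ by simp [image_eq_zero_of_notMem_tsupport hx]

lemma integrable_sq (hu : testFun ω u) : Integrable fun x ↦ u x ^ 2 :=
  (hu.continuous.pow 2).integrable_of_hasCompactSupport hu.hasCompactSupport_sq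

lemma integrable_mul (hu : testFun ω u) (hv : testFun ω v) : Integrable fun x ↦ u x * v x :=
  (hu.continuous.mul hv.continuous).integrable_of_hasCompactSupport hu.2.1.mul_right

lemma gradSq_eq_zero {x : ℝ × ℝ} (hx : x ∉ tsupport u) : gradSq u x = 0 := by
  simp [gradSq, fderiv_of_notMem_tsupport (𝕜 := ℝ) hx]

lemma continuous_gradSq (hu : ContDiff ℝ (⊤ : ℕ∞) u) : Continuous (gradSq u) := by
  have : Continuous (fderiv ℝ u) := hu.continuous_fderiv (by simp)
  unfold gradSq
  fun_prop

lemma integrable_gradSq (hu : testFun ω u) : Integrable (gradSq u) :=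
  (continuous_gradSq hu.1).integrable_of_hasCompactSupport
    (HasCompactSupport.intro hu.2.1 fun _ hx ↦ gradSq_eq_zero hx)

lemma rayleigh_eq (hu : testFun ω u) :
    rayleigh ω u = (∫ x, gradSq u x) / ∫ x, u x ^ 2 := by
  unfold rayleigh
  rw [setIntegral_eq_integral_of_forall_compl_eq_zero
    fun x hx ↦ gradSq_eq_zero fun h ↦ hx (hu.2.2 h),
    setIntegral_eq_integral_of_forall_compl_eq_zero fun x hx ↦ by
      simp [image_eq_zero_of_notMem_tsupport fun h ↦ hx (hu.2.2 h)]]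

lemma integral_sq_pos (hu : testFun ω u) (h : u ≠ 0) : 0 < ∫ x, u x ^ 2 := by
  obtain ⟨x, hx⟩ := Function.ne_iff.1 h
  exact (hu.continuous.pow 2).integral_pos_of_hasCompactSupport_nonneg_nonzero (x := x)
    hu.hasCompactSupport_sq (fun x ↦ sq_nonneg (u x))
    (by simpa using hx)

lemma gradSq_nonneg (u : ℝ × ℝ → ℝ) (x : ℝ × ℝ) : 0 ≤ gradSq u x := by
  unfold gradSq; positivity

lemma rayleigh_nonneg (ω : Set (ℝ × ℝ)) (u : ℝ × ℝ → ℝ) : 0 ≤ rayleigh ω u :=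
  div_nonneg (integral_nonneg fun x ↦ gradSq_nonneg u x) (integral_nonneg fun _ ↦ sq_nonneg _)

lemma fderiv_linear_comb (hu : Differentiable ℝ u) (hv : Differentiable ℝ v) (a b : ℝ)
    (x w : ℝ × ℝ) :
    fderiv ℝ (a • u + b • v) x w = a * fderiv ℝ u x w + b * fderiv ℝ v x w := by
  rw [fderiv_add ((hu x).const_smul a) ((hv x).const_smul b), fderiv_const_smul (hu x),
    fderiv_const_smul (hv x)]
  rfl

lemma integral_gradSq_linear_comb_le (hu : testFun ω u) (hv : testFun ω v) (a b : ℝ) :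
    ∫ x, gradSq (a • u + b • v) x ≤
      2 * a ^ 2 * (∫ x, gradSq u x) + 2 * b ^ 2 * ∫ x, gradSq v x := by
  rw [← integral_const_mul, ← integral_const_mul, ← integral_add
    (hu.integrable_gradSq.const_mul _) (hv.integrable_gradSq.const_mul _)]
  refine integral_mono (hu.linear_comb hv a b).integrable_gradSq
    ((hu.integrable_gradSq.const_mul _).add (hv.integrable_gradSq.const_mul _)) fun x ↦ ?_
  simp only [gradSq, fderiv_linear_comb hu.differentiable hv.differentiable]
  nlinarith [sq_nonneg (a * fderiv ℝ u x (1, 0) - b * fderiv ℝ v x (1, 0)),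
    sq_nonneg (a * fderiv ℝ u x (0, 1) - b * fderiv ℝ v x (0, 1))]

lemma integral_sq_linear_comb (hu : testFun ω u) (hv : testFun ω v) (a b : ℝ) :
    ∫ x, (a • u + b • v) x ^ 2 =
      a ^ 2 * (∫ x, u x ^ 2) + 2 * a * b * (∫ x, u x * v x) + b ^ 2 * ∫ x, v x ^ 2 := by
  have e : ∀ x, (a • u + b • v) x ^ 2 =
      a ^ 2 * u x ^ 2 + 2 * a * b * (u x * v x) + b ^ 2 * v x ^ 2 := fun x ↦ by
    simp only [Pi.add_apply, Pi.smul_apply, smul_eq_mul]; ring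
  simp_rw [e]
  rw [integral_add (f := fun x ↦ a ^ 2 * u x ^ 2 + 2 * a * b * (u x * v x))
    ((hu.integrable_sq.const_mul _).add ((hu.integrable_mul hv).const_mul _))
    (hv.integrable_sq.const_mul _), integral_add (hu.integrable_sq.const_mul _)
    ((hu.integrable_mul hv).const_mul _), integral_const_mul, integral_const_mul,
    integral_const_mul]

end testFun

lemma bddAbove_rayleigh {ω : Set (ℝ × ℝ)} {V : Submodule ℝ ((ℝ × ℝ) → ℝ)}
    (hV : (V : Set ((ℝ × ℝ) → ℝ)) ⊆ {u | testFun ω u}) (h2 : Module.finrank ℝ V = 2) :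
    BddAbove {r | ∃ u ∈ V, u ≠ 0 ∧ r = rayleigh ω u} := by
  have : Module.Finite ℝ V := Module.finite_of_finrank_pos (by omega)
  let B := Module.finBasisOfFinrankEq ℝ V h2
  set u : ℝ × ℝ → ℝ := ↑(B 0)
  set v : ℝ × ℝ → ℝ := ↑(B 1)
  have hu : testFun ω u := hV (B 0).2
  have hv : testFun ω v := hV (B 1).2
  have hu0 : u ≠ 0 := fun h ↦ B.ne_zero 0 (Subtype.ext h)
  have hp := hu.integral_sq_pos hu0
  set p := ∫ x, u x ^ 2
  set q := ∫ x, u x * v x with hq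
  set c := -(q / p) with hc
  set v' : ℝ × ℝ → ℝ := c • u + (1 : ℝ) • v with hv'
  have hvt : testFun ω v' := hu.linear_comb hv _ _
  have hv0 : v' ≠ 0 := fun h ↦ by
    have hB : c • B 0 + (1 : ℝ) • B 1 = 0 := Subtype.ext h
    have := LinearIndependent.pair_iff.1 (by
      convert B.linearIndependent
      ext i; fin_cases i <;> rfl : LinearIndependent ℝ ![B 0, B 1]) c 1 hB
    simp at this
  have hs := hvt.integral_sq_pos hv0
  have horth : ∫ x, u x * v' x = 0 := by
    have e : ∀ x, u x * v' x = c * u x ^ 2 + u x * v x := fun x ↦ by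
      simp only [hv', Pi.add_apply, Pi.smul_apply, smul_eq_mul]; ring
    simp_rw [e]
    rw [integral_add (hu.integrable_sq.const_mul _) (hu.integrable_mul hv), integral_const_mul,
      ← hq, hc]
    change -(q / p) * p + q = 0
    rw [neg_mul, div_mul_cancel₀ _ hp.ne', neg_add_cancel]
  set E := ∫ x, gradSq u x
  set E' := ∫ x, gradSq v' x
  set s := ∫ x, v' x ^ 2
  have hE : 0 ≤ E := integral_nonneg fun x ↦ testFun.gradSq_nonneg u x
  have hE' : 0 ≤ E' := integral_nonneg fun x ↦ testFun.gradSq_nonneg v' x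
  refine ⟨2 * E / p + 2 * E' / s, ?_⟩
  rintro _ ⟨w, hw, hw0, rfl⟩
  have hwt : testFun ω w := hV hw
  rw [hwt.rayleigh_eq, div_le_iff₀ (hwt.integral_sq_pos hw0)]
  obtain ⟨a, b, rfl⟩ : ∃ a b : ℝ, w = a • u + b • v' := by
    have h := B.sum_repr ⟨w, hw⟩
    rw [Fin.sum_univ_two] at h
    have h' : w = B.repr ⟨w, hw⟩ 0 • u + B.repr ⟨w, hw⟩ 1 • v := (congrArg Subtype.val h).symm
    refine ⟨B.repr ⟨w, hw⟩ 0 - B.repr ⟨w, hw⟩ 1 * c, B.repr ⟨w, hw⟩ 1, ?_⟩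
    conv_lhs => rw [h']
    simp only [hv']
    module
  refine (hu.integral_gradSq_linear_comb_le hvt a b).trans ?_
  rw [hu.integral_sq_linear_comb hvt, horth]
  change 2 * a ^ 2 * E + 2 * b ^ 2 * E' ≤ (2 * E / p + 2 * E' / s) *
    (a ^ 2 * p + 2 * a * b * 0 + b ^ 2 * s)
  have e : (2 * E / p + 2 * E' / s) * (a ^ 2 * p + 2 * a * b * 0 + b ^ 2 * s) =
      2 * a ^ 2 * E + 2 * b ^ 2 * E' + 2 * (a ^ 2 * (E' / s) * p + b ^ 2 * (E / p) * s) := by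
    field_simp
    ring
  rw [e]
  have : 0 ≤ 2 * (a ^ 2 * (E' / s) * p + b ^ 2 * (E / p) * s) := by positivity
  linarith

lemma dirichletEV_le_of_submodule {ω : Set (ℝ × ℝ)} {k : ℕ} {V : Submodule ℝ ((ℝ × ℝ) → ℝ)}
    (hV : (V : Set ((ℝ × ℝ) → ℝ)) ⊆ {u | testFun ω u}) (hk : Module.finrank ℝ V = k) :
    dirichletEV ω k ≤ sSup {r | ∃ u ∈ V, u ≠ 0 ∧ r = rayleigh ω u} := by
  refine csInf_le ⟨0, ?_⟩ ⟨V, hV, hk, rfl⟩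
  rintro _ ⟨V, -, -, rfl⟩
  exact Real.sSup_nonneg (by rintro _ ⟨u, -, -, rfl⟩; exact testFun.rayleigh_nonneg ω u)

/-- Domain monotonicity of Dirichlet eigenvalues. -/
lemma dirichletEV_mono {ω ω' : Set (ℝ × ℝ)} {k : ℕ} (h : ω ⊆ ω')
    (hne : ∃ V : Submodule ℝ ((ℝ × ℝ) → ℝ),
      (V : Set ((ℝ × ℝ) → ℝ)) ⊆ {u | testFun ω u} ∧ Module.finrank ℝ V = k) :
    dirichletEV ω' k ≤ dirichletEV ω k := by
  obtain ⟨V, hV, hk⟩ := hne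
  refine le_csInf ⟨_, V, hV, hk, rfl⟩ ?_
  rintro _ ⟨V, hV, hk, rfl⟩
  refine (dirichletEV_le_of_submodule (fun u hu ↦ (hV hu).mono h) hk).trans_eq ?_
  congr 1
  ext r
  refine exists_congr fun u ↦ and_congr_right fun hu ↦ and_congr_right fun _ ↦ ?_
  rw [(hV hu).rayleigh_eq, ((hV hu).mono h).rayleigh_eq]

lemma exists_tsupport_subset_disk {R r₀ : ℝ} (hr₀ : 0 < r₀) (hR : r₀ < R) {u : ℝ × ℝ → ℝ}
    (hu : testFun (disk R) u) (hu0 : u ≠ 0) : ∃ ρ, r₀ < ρ ∧ ρ < R ∧ tsupport u ⊆ disk ρ := by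
  obtain ⟨x, hx⟩ := Function.ne_iff.1 hu0
  obtain ⟨z, hz, hmax⟩ := hu.2.1.exists_isMaxOn ⟨x, subset_tsupport u hx⟩
    (f := fun x : ℝ × ℝ ↦ x.1 ^ 2 + x.2 ^ 2) (by fun_prop)
  have hzR : z.1 ^ 2 + z.2 ^ 2 < R ^ 2 := hu.2.2 hz
  obtain ⟨c, hc1, hc2⟩ := exists_between (max_lt hzR (pow_lt_pow_left₀ hR hr₀.le two_ne_zero))
  rw [max_lt_iff] at hc1
  have hc0 : 0 ≤ c := (sq_nonneg r₀).trans hc1.2.le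
  refine ⟨√c, lt_sqrt_of_sq_lt hc1.2, (sqrt_lt' (hr₀.trans hR)).2 hc2, fun y hy ↦ ?_⟩
  change y.1 ^ 2 + y.2 ^ 2 < √c ^ 2
  rw [sq_sqrt hc0]
  exact lt_of_le_of_lt (hmax hy) hc1.1

/-- The variational lower bound for the second Dirichlet eigenvalue of the disk. -/
lemma le_sSup_rayleigh_disk {R t₀ t₁ : ℝ} (hR : 0 < R) (ht₀ : 0 < t₀) (ht : t₀ < t₁)
    (hb1 : ∀ t ∈ Ico 0 t₁, 0 < besselSeries 1 t)
    (hz : besselSeries 0 t₀ = 0) (hb0 : ∀ t ∈ Ico 0 t₀, 0 < besselSeries 0 t)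
    (hb0' : ∀ t ∈ Ioc t₀ t₁, besselSeries 0 t < 0) {V : Submodule ℝ ((ℝ × ℝ) → ℝ)}
    (hV : (V : Set ((ℝ × ℝ) → ℝ)) ⊆ {u | testFun (disk R) u}) (h2 : Module.finrank ℝ V = 2) :
    4 * (t₁ / R ^ 2) ≤ sSup {r | ∃ u ∈ V, u ≠ 0 ∧ r = rayleigh (disk R) u} := by
  have : Module.Finite ℝ V := Module.finite_of_finrank_pos (by omega)
  have ht₁ : 0 < t₁ := ht₀.trans ht
  have hκ : 0 < t₁ / R ^ 2 := by positivity
  set r₀ := R * √(t₀ / t₁) with hr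
  have hr₀ : 0 < r₀ := by positivity
  have hr₀R : r₀ < R := by
    have : √(t₀ / t₁) < 1 := by
      rw [sqrt_lt' one_pos, one_pow, div_lt_one ht₁]; exact ht
    nlinarith
  have hsplit : ∀ u ∈ V, IntervalIntegrable (fun θ ↦ u (r₀ * cos θ, r₀ * sin θ)) volume (-π) π :=
    fun u hu ↦ by
      have := (hV hu).continuous
      exact Continuous.intervalIntegrable (by fun_prop) _ _
  let L : V →ₗ[ℝ] ℝ :=
    { toFun := fun u ↦ ∫ θ in -π..π, (u : ℝ × ℝ → ℝ) (r₀ * cos θ, r₀ * sin θ)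
      map_add' := fun u v ↦ by
        rw [← intervalIntegral.integral_add (hsplit u u.2) (hsplit v v.2)]
        rfl
      map_smul' := fun c u ↦ by
        rw [RingHom.id_apply, smul_eq_mul, ← intervalIntegral.integral_const_mul]
        rfl }
  have hL : LinearMap.ker L ≠ ⊥ := L.ker_ne_bot_of_finrank_lt (by simp [h2])
  obtain ⟨⟨u, hu⟩, hLu, hne⟩ := (Submodule.ne_bot_iff _).1 hL
  have hu0 : u ≠ 0 := fun h ↦ hne (Subtype.ext h)
  have hut : testFun (disk R) u := hV hu
  obtain ⟨ρ, hρ, hρR, hsupp⟩ := exists_tsupport_subset_disk hr₀ hr₀R hut hu0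
  have key := rayleigh_lower_bound hκ hr₀ hρ
    (by rw [hr, mul_pow, sq_sqrt (by positivity)]; field_simp)
    (by
      rw [div_mul_eq_mul_div, div_lt_iff₀ (by positivity)]
      have : ρ ^ 2 < R ^ 2 := by gcongr; exact (hr₀.trans hρ).le
      gcongr)
    hb1 hz hb0 hb0' hut.1 hsupp hLu
  refine le_csSup_of_le (bddAbove_rayleigh hV h2) ⟨u, hu, hu0, rfl⟩ ?_
  rw [hut.rayleigh_eq, le_div_iff₀ (hut.integral_sq_pos hu0)]
  exact key

/-- The reflection of the plane in the second coordinate axis. -/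
def reflectFst : (ℝ × ℝ) ≃L[ℝ] (ℝ × ℝ) :=
  (ContinuousLinearEquiv.neg ℝ).prodCongr (ContinuousLinearEquiv.refl ℝ ℝ)

lemma reflectFst_apply (x : ℝ × ℝ) : reflectFst x = (-x.1, x.2) := rfl

lemma measurePreserving_reflectFst : MeasurePreserving reflectFst :=
  (Measure.measurePreserving_neg (volume : Measure ℝ)).prod (MeasurePreserving.id volume)

lemma integral_comp_reflectFst (f : ℝ × ℝ → ℝ) : ∫ x, f (reflectFst x) = ∫ x, f x :=
  measurePreserving_reflectFst.integral_comp
    reflectFst.toHomeomorph.measurableEmbedding f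

lemma gradSq_comp_reflectFst {v : ℝ × ℝ → ℝ} (hv : Differentiable ℝ v) (x : ℝ × ℝ) :
    gradSq (v ∘ reflectFst) x = gradSq v (reflectFst x) := by
  have h : ∀ y, fderiv ℝ (v ∘ reflectFst) x y = fderiv ℝ v (reflectFst x) (reflectFst y) :=
    fun y ↦ by rw [fderiv_comp x (hv _) reflectFst.differentiableAt, reflectFst.fderiv]; rfl
  simp only [gradSq, h, reflectFst_apply, neg_zero]
  rw [show ((-1, 0) : ℝ × ℝ) = -(1, 0) by simp, map_neg, neg_sq]

lemma testFun.comp_reflectFst {ω : Set (ℝ × ℝ)} {v : ℝ × ℝ → ℝ}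
    (hv : testFun ω v) : testFun (reflectFst ⁻¹' ω) (v ∘ reflectFst) := by
  refine ⟨hv.1.comp reflectFst.contDiff, hv.2.1.comp_homeomorph reflectFst.toHomeomorph, ?_⟩
  have := tsupport_comp_eq_preimage v reflectFst.toHomeomorph
  exact this.subset.trans (preimage_mono hv.2.2)

/-- On a domain symmetric under reflection, a test function supported in the right half gives
a two-dimensional space on which the Rayleigh quotient is constant. -/
lemma exists_submodule_of_reflection {ω : Set (ℝ × ℝ)} (hω : ∀ x ∈ ω, reflectFst x ∈ ω)
    {v : ℝ × ℝ → ℝ} (hv : testFun (ω ∩ {x | 0 < x.1}) v) (hv0 : v ≠ 0) :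
    ∃ V : Submodule ℝ ((ℝ × ℝ) → ℝ), (V : Set ((ℝ × ℝ) → ℝ)) ⊆ {u | testFun ω u} ∧
      Module.finrank ℝ V = 2 ∧
      ∀ u ∈ V, u ≠ 0 → rayleigh ω u = (∫ x, gradSq v x) / ∫ x, v x ^ 2 := by
  set w : ℝ × ℝ → ℝ := v ∘ reflectFst with hw
  have hinv : ∀ x, reflectFst (reflectFst x) = x := fun x ↦ by simp [reflectFst_apply]
  have hvω : testFun ω v := hv.mono inter_subset_left
  have hwt := hv.comp_reflectFst
  have hwω : testFun ω w := hwt.mono fun x hx ↦ by simpa [hinv] using hω _ hx.1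
  have hvx : ∀ x : ℝ × ℝ, x.1 ≤ 0 → x ∉ tsupport v := fun x hx h ↦ not_lt.2 hx (hv.2.2 h).2
  have hwx : ∀ x : ℝ × ℝ, 0 ≤ x.1 → x ∉ tsupport w := fun x hx h ↦ by
    have : 0 < (reflectFst x).1 := (hwt.2.2 h).2
    rw [reflectFst_apply] at this
    simp only at this
    linarith
  have hNw : ∫ x, w x ^ 2 = ∫ x, v x ^ 2 := integral_comp_reflectFst fun x ↦ v x ^ 2
  have hEw : ∫ x, gradSq w x = ∫ x, gradSq v x := by
    rw [← integral_comp_reflectFst (gradSq v)]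
    simp_rw [hw, gradSq_comp_reflectFst hv.differentiable]
  have hvw : ∫ x, v x * w x = 0 := by
    have : ∀ x, v x * w x = 0 := fun x ↦ by
      rcases le_total x.1 0 with h | h
      · rw [image_eq_zero_of_notMem_tsupport (hvx x h), zero_mul]
      · rw [image_eq_zero_of_notMem_tsupport (hwx x h), mul_zero]
    simp [this]
  have hN : 0 < ∫ x, v x ^ 2 := hvω.integral_sq_pos hv0
  have hsq : ∀ a b : ℝ, ∫ x, (a • v + b • w) x ^ 2 = (a ^ 2 + b ^ 2) * ∫ x, v x ^ 2 :=
    fun a b ↦ by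
      rw [hvω.integral_sq_linear_comb hwω, hvw, hNw]
      ring
  have hgr : ∀ a b : ℝ, ∫ x, gradSq (a • v + b • w) x = (a ^ 2 + b ^ 2) * ∫ x, gradSq v x :=
    fun a b ↦ by
      have e : ∀ x, gradSq (a • v + b • w) x = a ^ 2 * gradSq v x + b ^ 2 * gradSq w x := by
        intro x
        simp only [gradSq, testFun.fderiv_linear_comb hvω.differentiable hwω.differentiable]
        rcases le_total x.1 0 with h | h
        · simp only [fderiv_of_notMem_tsupport (𝕜 := ℝ) (hvx x h), zero_apply]
          ring
        · simp only [fderiv_of_notMem_tsupport (𝕜 := ℝ) (hwx x h), zero_apply]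
          ring
      simp_rw [e]
      rw [integral_add (hvω.integrable_gradSq.const_mul _) (hwω.integrable_gradSq.const_mul _),
        integral_const_mul, integral_const_mul, hEw]
      ring
  have hli : LinearIndependent ℝ ![v, w] := by
    refine LinearIndependent.pair_iff.2 fun a b hab ↦ ?_
    have h := hsq a b
    rw [hab] at h
    have h' : (a ^ 2 + b ^ 2) * ∫ x, v x ^ 2 = 0 := by simpa using h.symm
    have h'' : a ^ 2 + b ^ 2 = 0 := (mul_eq_zero.1 h').resolve_right hN.ne'
    exact ⟨by nlinarith, by nlinarith⟩
  have hmem : ∀ u ∈ Submodule.span ℝ (range ![v, w]), ∃ a b : ℝ, u = a • v + b • w := by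
    intro u hu
    rw [Matrix.range_cons, Matrix.range_cons, Matrix.range_empty, union_empty,
      singleton_union, Submodule.mem_span_pair] at hu
    obtain ⟨a, b, rfl⟩ := hu
    exact ⟨a, b, rfl⟩
  refine ⟨Submodule.span ℝ (range ![v, w]), ?_, ?_, ?_⟩
  · intro u hu
    obtain ⟨a, b, rfl⟩ := hmem u hu
    exact hvω.linear_comb hwω a b
  · simpa using finrank_span_eq_card hli
  · intro u hu hu0
    obtain ⟨a, b, rfl⟩ := hmem u hu
    have hne : a ^ 2 + b ^ 2 ≠ 0 := fun h ↦ by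
      have h1 := (hvω.linear_comb hwω a b).integral_sq_pos hu0
      rw [hsq, h, zero_mul] at h1
      exact lt_irrefl _ h1
    rw [(hvω.linear_comb hwω a b).rayleigh_eq, hsq, hgr, mul_div_mul_left _ _ hne]

lemma dirichletEV_two_le_of_reflection {ω : Set (ℝ × ℝ)} (hω : ∀ x ∈ ω, reflectFst x ∈ ω)
    {v : ℝ × ℝ → ℝ} (hv : testFun (ω ∩ {x | 0 < x.1}) v) (hv0 : v ≠ 0) :
    dirichletEV ω 2 ≤ (∫ x, gradSq v x) / ∫ x, v x ^ 2 := by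
  obtain ⟨V, hV, h2, hr⟩ := exists_submodule_of_reflection hω hv hv0
  refine (dirichletEV_le_of_submodule hV h2).trans (Real.sSup_le ?_ ?_)
  · rintro _ ⟨u, hu, hu0, rfl⟩
    exact (hr u hu hu0).le
  · exact div_nonneg (integral_nonneg fun x ↦ testFun.gradSq_nonneg v x)
      (integral_nonneg fun _ ↦ sq_nonneg _)

lemma integral_mul_fderiv_eq_of_hasCompactSupport {f g : ℝ × ℝ → ℝ} (hf : ContDiff ℝ (⊤ : ℕ∞) f)
    (hg : ContDiff ℝ (⊤ : ℕ∞) g) (hc : HasCompactSupport g) (v : ℝ × ℝ) :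
    ∫ x, f x * fderiv ℝ g x v = -∫ x, fderiv ℝ f x v * g x := by
  have hfc : Continuous (fderiv ℝ f) := hf.continuous_fderiv (by simp)
  have hgc : Continuous (fderiv ℝ g) := hg.continuous_fderiv (by simp)
  have hf' := hf.continuous
  have hg' := hg.continuous
  refine integral_mul_fderiv_eq_neg_fderiv_mul_of_integrable ?_ ?_ ?_
    (fun x _ ↦ hf.differentiable (by simp) x) (fun x _ ↦ hg.differentiable (by simp) x)
  · exact Continuous.integrable_of_hasCompactSupport (by fun_prop) hc.mul_left
  · exact Continuous.integrable_of_hasCompactSupport (by fun_prop)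
      (hc.fderiv_apply (𝕜 := ℝ) v).mul_left
  · exact Continuous.integrable_of_hasCompactSupport (by fun_prop) hc.mul_left

/-- The ground state representation: if `-Δu = μ u`, then the Dirichlet energy of `u χ` is
`μ ∫ (u χ)² + ∫ u² |∇χ|²`. -/
lemma integral_gradSq_mul_eq {μ : ℝ} {u χ : ℝ × ℝ → ℝ} (hu : ContDiff ℝ (⊤ : ℕ∞) u)
    (hχ : ContDiff ℝ (⊤ : ℕ∞) χ) (hc : HasCompactSupport χ)
    (hΔ : ∀ x, fderiv ℝ (fun y ↦ fderiv ℝ u y (1, 0)) x (1, 0) +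
      fderiv ℝ (fun y ↦ fderiv ℝ u y (0, 1)) x (0, 1) = -(μ * u x)) :
    ∫ x, gradSq (fun y ↦ u y * χ y) x =
      μ * (∫ x, (u x * χ x) ^ 2) + ∫ x, u x ^ 2 * gradSq χ x := by
  have hud : Differentiable ℝ u := hu.differentiable (by simp)
  have hχd : Differentiable ℝ χ := hχ.differentiable (by simp)
  have hp : ∀ v, ContDiff ℝ (⊤ : ℕ∞) fun y ↦ fderiv ℝ u y v := fun v ↦
    (hu.fderiv_right (m := (⊤ : ℕ∞)) (by simp)).clm_apply contDiff_const
  set g : ℝ × ℝ → ℝ := fun y ↦ χ y * (χ y * u y) with hg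
  have hgs : ContDiff ℝ (⊤ : ℕ∞) g := hχ.mul (hχ.mul hu)
  have hgc : HasCompactSupport g := hc.mul_right
  have hgd : ∀ x v, fderiv ℝ g x v =
      χ x ^ 2 * fderiv ℝ u x v + 2 * χ x * u x * fderiv ℝ χ x v := fun x v ↦ by
    rw [hg, fderiv_fun_mul (hχd x) ((hχd x).fun_mul (hud x)), fderiv_fun_mul (hχd x) (hud x)]
    simp only [add_apply, smul_apply, smul_eq_mul]
    ring
  have hwd : ∀ x v, fderiv ℝ (fun y ↦ u y * χ y) x v =
      u x * fderiv ℝ χ x v + χ x * fderiv ℝ u x v := fun x v ↦ by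
    rw [fderiv_fun_mul (hud x) (hχd x)]
    simp only [add_apply, smul_apply, smul_eq_mul]
  have h1 := integral_mul_fderiv_eq_of_hasCompactSupport (hp (1, 0)) hgs hgc (1, 0)
  have h2 := integral_mul_fderiv_eq_of_hasCompactSupport (hp (0, 1)) hgs hgc (0, 1)
  have hcs : ∀ {f : ℝ × ℝ → ℝ}, Continuous f → (∀ x, x ∉ tsupport χ → f x = 0) → Integrable f :=
    fun hf h ↦ hf.integrable_of_hasCompactSupport (HasCompactSupport.intro hc h)
  have hχc : Continuous (fderiv ℝ χ) := hχ.continuous_fderiv (by simp)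
  have huc : Continuous (fderiv ℝ u) := hu.continuous_fderiv (by simp)
  have hgc' : Continuous (fderiv ℝ g) := hgs.continuous_fderiv (by simp)
  have hpc : ∀ v, Continuous (fderiv ℝ (fun y ↦ fderiv ℝ u y v)) := fun v ↦
    (hp v).continuous_fderiv (by simp)
  have hu' := hu.continuous
  have hχ' := hχ.continuous
  have hg' := hgs.continuous
  have z1 : ∀ x, x ∉ tsupport χ → χ x = 0 := fun x hx ↦ image_eq_zero_of_notMem_tsupport hx
  have z2 : ∀ x, x ∉ tsupport χ → fderiv ℝ χ x = 0 := fun x hx ↦ fderiv_of_notMem_tsupport (𝕜 := ℝ) hx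
  have e1 : ∫ x, (fderiv ℝ u x (1, 0) * fderiv ℝ g x (1, 0) +
      fderiv ℝ u x (0, 1) * fderiv ℝ g x (0, 1)) = μ * ∫ x, (u x * χ x) ^ 2 := by
    rw [integral_add, h1, h2, ← neg_add, ← integral_add, ← integral_neg, ← integral_const_mul]
    · congr 1
      ext x
      linear_combination -(g x) * hΔ x
    · exact hcs ((hpc _).clm_apply continuous_const |>.mul hg') fun x hx ↦ by simp [hg, z1 x hx]
    · exact hcs ((hpc _).clm_apply continuous_const |>.mul hg') fun x hx ↦ by simp [hg, z1 x hx]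
    · exact hcs (by fun_prop) fun x hx ↦ by simp [hgd, z1 x hx]
    · exact hcs (by fun_prop) fun x hx ↦ by simp [hgd, z1 x hx]
  rw [← e1, ← integral_add]
  · congr 1
    ext x
    simp only [gradSq, hwd, hgd]
    ring
  · exact hcs (by fun_prop) fun x hx ↦ by simp [hgd, z1 x hx]
  · exact hcs (by unfold gradSq; fun_prop) fun x hx ↦ by simp [gradSq, z2 x hx]

/-- A smooth step from `0` on `(-∞, 1]` to `1` on `[2, ∞)` with bounded derivative. -/
lemma exists_smooth_step : ∃ η : ℝ → ℝ, ContDiff ℝ (⊤ : ℕ∞) η ∧ (∀ t, 0 ≤ η t) ∧ (∀ t, η t ≤ 1) ∧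
    (∀ t ≤ 1, η t = 0) ∧ (∀ t, 2 ≤ t → η t = 1) ∧ (∀ t, t ∉ Icc (1 : ℝ) 2 → deriv η t = 0) ∧
    ∃ K, ∀ t, deriv η t ^ 2 ≤ K := by
  have hs : ContDiff ℝ (⊤ : ℕ∞) fun t ↦ smoothTransition (t - 1) :=
    smoothTransition.contDiff.comp (contDiff_id.sub contDiff_const)
  have h0 : ∀ t ≤ (1 : ℝ), smoothTransition (t - 1) = 0 := fun t ht ↦
    smoothTransition.zero_of_nonpos (by linarith)
  have h1 : ∀ t, (2 : ℝ) ≤ t → smoothTransition (t - 1) = 1 := fun t ht ↦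
    smoothTransition.one_of_one_le (by linarith)
  have hd : ∀ t, t ∉ Icc (1 : ℝ) 2 → deriv (fun t ↦ smoothTransition (t - 1)) t = 0 := by
    intro t ht
    rw [mem_Icc, not_and_or, not_le, not_le] at ht
    rcases ht with ht | ht
    · have : (fun t ↦ smoothTransition (t - 1)) =ᶠ[nhds t] fun _ ↦ 0 := by
        filter_upwards [Iio_mem_nhds ht] with x hx using h0 x (le_of_lt hx)
      rw [this.deriv_eq, deriv_const]
    · have : (fun t ↦ smoothTransition (t - 1)) =ᶠ[nhds t] fun _ ↦ 1 := by
        filter_upwards [Ioi_mem_nhds ht] with x hx using h1 x (le_of_lt hx)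
      rw [this.deriv_eq, deriv_const]
  refine ⟨_, hs, fun t ↦ smoothTransition.nonneg _, fun t ↦ smoothTransition.le_one _, h0, h1,
    hd, ?_⟩
  have hc : Continuous (deriv fun t ↦ smoothTransition (t - 1)) := hs.continuous_deriv (by simp)
  obtain ⟨K, hK⟩ := (isCompact_Icc (a := (1 : ℝ)) (b := 2)).exists_bound_of_continuousOn
    (hc.pow 2).continuousOn
  refine ⟨K, fun t ↦ ?_⟩
  by_cases ht : t ∈ Icc (1 : ℝ) 2
  · exact (le_abs_self _).trans (hK t ht)
  · rw [hd t ht]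
    simpa using (norm_nonneg _).trans (hK 1 (by simp))

lemma gradSq_comp {η : ℝ → ℝ} (hη : Differentiable ℝ η) {f : ℝ × ℝ → ℝ} {x : ℝ × ℝ}
    (hf : DifferentiableAt ℝ f x) :
    gradSq (fun y ↦ η (f y)) x = deriv η (f x) ^ 2 * gradSq f x := by
  have h : ∀ v, fderiv ℝ (fun y ↦ η (f y)) x v = deriv η (f x) * fderiv ℝ f x v := fun v ↦ by
    have := ((hη (f x)).hasDerivAt.comp_hasFDerivAt x hf.hasFDerivAt).fderiv
    rw [show (fun y ↦ η (f y)) = η ∘ f from rfl, this]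
    rfl
  simp only [gradSq, h]
  ring

lemma gradSq_mul_le {f g : ℝ × ℝ → ℝ} {x : ℝ × ℝ} (hf : DifferentiableAt ℝ f x)
    (hg : DifferentiableAt ℝ g x) (hf0 : 0 ≤ f x) (hf1 : f x ≤ 1) (hg0 : 0 ≤ g x) (hg1 : g x ≤ 1) :
    gradSq (fun y ↦ f y * g y) x ≤ 2 * gradSq f x + 2 * gradSq g x := by
  have hw : ∀ v, fderiv ℝ (fun y ↦ f y * g y) x v =
      f x * fderiv ℝ g x v + g x * fderiv ℝ f x v := fun v ↦ by
    rw [fderiv_fun_mul hf hg]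
    simp only [add_apply, smul_apply, smul_eq_mul]
  have h : ∀ a b : ℝ, (f x * b + g x * a) ^ 2 ≤ 2 * a ^ 2 + 2 * b ^ 2 := fun a b ↦ by
    have h1 : (f x * b) ^ 2 ≤ b ^ 2 := by
      rw [mul_pow]
      exact mul_le_of_le_one_left (sq_nonneg b) (pow_le_one₀ hf0 hf1)
    have h2 : (g x * a) ^ 2 ≤ a ^ 2 := by
      rw [mul_pow]
      exact mul_le_of_le_one_left (sq_nonneg a) (pow_le_one₀ hg0 hg1)
    nlinarith [sq_nonneg (f x * b - g x * a)]
  simp only [gradSq, hw]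
  have := h (fderiv ℝ f x (1, 0)) (fderiv ℝ g x (1, 0))
  have := h (fderiv ℝ f x (0, 1)) (fderiv ℝ g x (0, 1))
  linarith

lemma hasFDerivAt_besselSeries_radial (n : ℕ) (κ : ℝ) (x : ℝ × ℝ) :
    HasFDerivAt (fun y : ℝ × ℝ ↦ besselSeries n (κ * (y.1 ^ 2 + y.2 ^ 2)))
      ((-(2 * κ * besselSeries (n + 1) (κ * (x.1 ^ 2 + x.2 ^ 2)))) •
        (x.1 • ContinuousLinearMap.fst ℝ ℝ ℝ + x.2 • ContinuousLinearMap.snd ℝ ℝ ℝ)) x := by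
  have h1 : HasFDerivAt (fun y : ℝ × ℝ ↦ y.1) (ContinuousLinearMap.fst ℝ ℝ ℝ) x := hasFDerivAt_fst
  have h2 : HasFDerivAt (fun y : ℝ × ℝ ↦ y.2) (ContinuousLinearMap.snd ℝ ℝ ℝ) x := hasFDerivAt_snd
  have h3 := (((h1.pow 2).add (h2.pow 2)).const_mul κ)
  refine ((hasDerivAt_besselSeries n _).comp_hasFDerivAt x h3).congr_fderiv ?_
  ext <;> simp <;> ring

/-- The first odd Dirichlet mode `J₁(2√κ r) cos θ` of a disk, up to scaling. -/
def oddMode (κ : ℝ) (x : ℝ × ℝ) : ℝ := x.1 * besselSeries 1 (κ * (x.1 ^ 2 + x.2 ^ 2))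

lemma contDiff_oddMode (κ : ℝ) : ContDiff ℝ (⊤ : ℕ∞) (oddMode κ) :=
  contDiff_fst.mul ((contDiff_besselSeries 1).comp
    (contDiff_const.mul ((contDiff_fst.pow 2).add (contDiff_snd.pow 2))))

lemma fderiv_oddMode_fst (κ : ℝ) (x : ℝ × ℝ) : fderiv ℝ (oddMode κ) x (1, 0) =
    besselSeries 1 (κ * (x.1 ^ 2 + x.2 ^ 2)) -
      2 * κ * (x.1 ^ 2 * besselSeries 2 (κ * (x.1 ^ 2 + x.2 ^ 2))) := by
  have h1 : HasFDerivAt (fun y : ℝ × ℝ ↦ y.1) (ContinuousLinearMap.fst ℝ ℝ ℝ) x := hasFDerivAt_fst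
  have := (h1.mul (hasFDerivAt_besselSeries_radial 1 κ x)).fderiv
  rw [show oddMode κ = (fun y : ℝ × ℝ ↦ y.1) *
    fun y : ℝ × ℝ ↦ besselSeries 1 (κ * (y.1 ^ 2 + y.2 ^ 2)) from rfl, this]
  simp
  ring

lemma fderiv_oddMode_snd (κ : ℝ) (x : ℝ × ℝ) : fderiv ℝ (oddMode κ) x (0, 1) =
    -(2 * κ * (x.1 * x.2 * besselSeries 2 (κ * (x.1 ^ 2 + x.2 ^ 2)))) := by
  have h1 : HasFDerivAt (fun y : ℝ × ℝ ↦ y.1) (ContinuousLinearMap.fst ℝ ℝ ℝ) x := hasFDerivAt_fst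
  have := (h1.mul (hasFDerivAt_besselSeries_radial 1 κ x)).fderiv
  rw [show oddMode κ = (fun y : ℝ × ℝ ↦ y.1) *
    fun y : ℝ × ℝ ↦ besselSeries 1 (κ * (y.1 ^ 2 + y.2 ^ 2)) from rfl, this]
  simp
  ring

lemma laplacian_oddMode (κ : ℝ) (x : ℝ × ℝ) :
    fderiv ℝ (fun y ↦ fderiv ℝ (oddMode κ) y (1, 0)) x (1, 0) +
      fderiv ℝ (fun y ↦ fderiv ℝ (oddMode κ) y (0, 1)) x (0, 1) = -(4 * κ * oddMode κ x) := by
  have h1 : HasFDerivAt (fun y : ℝ × ℝ ↦ y.1) (ContinuousLinearMap.fst ℝ ℝ ℝ) x := hasFDerivAt_fst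
  have h2 : HasFDerivAt (fun y : ℝ × ℝ ↦ y.2) (ContinuousLinearMap.snd ℝ ℝ ℝ) x := hasFDerivAt_snd
  have h3 : HasFDerivAt (fun y : ℝ × ℝ ↦ y.1 ^ 2)
      ((2 * x.1) • ContinuousLinearMap.fst ℝ ℝ ℝ) x := by simpa using h1.pow 2
  have hB := hasFDerivAt_besselSeries_radial 2 κ x
  have e1 := ((hasFDerivAt_besselSeries_radial 1 κ x).fun_sub
    ((h3.fun_mul hB).const_mul (2 * κ))).fderiv
  have e2 := (((h1.fun_mul h2).fun_mul hB).const_mul (2 * κ)).fun_neg.fderiv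
  simp_rw [fderiv_oddMode_fst, fderiv_oddMode_snd]
  rw [e1, e2, oddMode, besselSeries_recurrence 1]
  simp
  ring

lemma continuous_oddMode (κ : ℝ) : Continuous (oddMode κ) := (contDiff_oddMode κ).continuous

lemma oddMode_pos {κ R t₁ : ℝ} (hκ : 0 < κ) (h : κ * R ^ 2 = t₁)
    (hb1 : ∀ t ∈ Ico 0 t₁, 0 < besselSeries 1 t) {x : ℝ × ℝ} (hx : x ∈ disk R ∩ {x | 0 < x.1}) :
    0 < oddMode κ x := by
  refine mul_pos hx.2 (hb1 _ ⟨by positivity, ?_⟩)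
  rw [← h]
  exact mul_lt_mul_of_pos_left hx.1 hκ

lemma gradSq_div_const (f : ℝ × ℝ → ℝ) (s : ℝ) (x : ℝ × ℝ) :
    gradSq (fun y ↦ f y / s) x = gradSq f x / s ^ 2 := by
  have e : (fun y ↦ f y / s) = s⁻¹ • f := by
    ext y
    simp [div_eq_inv_mul]
  rw [e]
  simp only [gradSq, fderiv_const_smul_field, smul_apply, Pi.smul_apply, smul_eq_mul]
  ring

lemma gradSq_congr {f g : ℝ × ℝ → ℝ} {x : ℝ × ℝ} (h : f =ᶠ[nhds x] g) :
    gradSq f x = gradSq g x := by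
  simp only [gradSq, h.fderiv_eq]

/-- A cutoff at the level sets `f ∈ [s, 2 s]` of a function `f` which is nonpositive on the
boundary of `H`. -/
lemma exists_levelSet_cutoff {η : ℝ → ℝ} {K : ℝ} (hη : ContDiff ℝ (⊤ : ℕ∞) η)
    (hη0 : ∀ t, 0 ≤ η t) (hη1 : ∀ t, η t ≤ 1) (hz : ∀ t ≤ 1, η t = 0)
    (ho : ∀ t, 2 ≤ t → η t = 1) (hd : ∀ t, t ∉ Icc (1 : ℝ) 2 → deriv η t = 0)
    (hK : ∀ t, deriv η t ^ 2 ≤ K) {f : ℝ × ℝ → ℝ} (hf : ContDiff ℝ (⊤ : ℕ∞) f)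
    {H C : Set (ℝ × ℝ)} (hH : IsOpen H) (hC : IsCompact C) (hHC : H ⊆ C)
    (hfC : ∀ x ∈ C, x ∉ H → f x ≤ 0) {s : ℝ} (hs : 0 < s) :
    ∃ χ, testFun H χ ∧ (∀ x, 0 ≤ χ x) ∧ (∀ x, χ x ≤ 1) ∧ (∀ x ∈ H, 2 * s ≤ f x → χ x = 1) ∧
      (∀ x, x ∉ H ∩ {x | f x ≤ 2 * s} → gradSq χ x = 0) ∧
      ∀ x, f x ^ 2 * gradSq χ x ≤ 4 * K * gradSq f x := by
  have hK0 : 0 ≤ K := (sq_nonneg _).trans (hK 0)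
  set χ : ℝ × ℝ → ℝ := H.indicator fun x ↦ η (f x / s) with hχ
  set S : Set (ℝ × ℝ) := C ∩ {x | s ≤ f x} with hS
  have hSc : IsCompact S := hC.inter_right (isClosed_le continuous_const hf.continuous)
  have hSH : S ⊆ H := fun x hx ↦ by
    by_contra h
    exact absurd (hfC x hx.1 h) (not_le.2 (hs.trans_le hx.2))
  have hχS : ∀ x, x ∉ S → χ x = 0 := fun x hx ↦ by
    by_cases h : x ∈ H
    · rw [hχ, indicator_of_mem h]
      refine hz _ ?_
      rw [div_le_one hs]
      by_contra! hle
      exact hx ⟨hHC h, hle.le⟩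
    · exact indicator_of_notMem h _
  have hloc : ∀ x ∈ H, χ =ᶠ[nhds x] fun x ↦ η (f x / s) := fun x hx ↦ by
    filter_upwards [hH.mem_nhds hx] with y hy using indicator_of_mem hy _
  have hloc0 : ∀ x, x ∉ S → χ =ᶠ[nhds x] fun _ ↦ 0 := fun x hx ↦ by
    filter_upwards [hSc.isClosed.isOpen_compl.mem_nhds hx] with y hy using hχS y hy
  have hsm : ContDiff ℝ (⊤ : ℕ∞) fun x ↦ η (f x / s) := hη.comp (hf.div_const s)
  have hsupp : Function.support χ ⊆ S := fun x hx ↦ by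
    by_contra h
    exact hx (hχS x h)
  have hgr : ∀ x ∈ H, gradSq χ x = deriv η (f x / s) ^ 2 * (gradSq f x / s ^ 2) := fun x hx ↦ by
    rw [gradSq_congr (hloc x hx), gradSq_comp (f := fun x ↦ f x / s)
      (hη.differentiable (by simp)) ((hf.div_const s).differentiable (by simp) x),
      gradSq_div_const]
  have hgr0 : ∀ x, x ∉ S → gradSq χ x = 0 := fun x hx ↦ by
    rw [gradSq_congr (hloc0 x hx)]
    simp [gradSq]
  refine ⟨χ, ⟨?_, HasCompactSupport.of_support_subset_isCompact hSc hsupp,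
    (closure_minimal hsupp hSc.isClosed).trans hSH⟩, ?_, ?_, ?_, ?_, ?_⟩
  · refine contDiff_iff_contDiffAt.2 fun x ↦ ?_
    by_cases hx : x ∈ H
    · exact hsm.contDiffAt.congr_of_eventuallyEq (hloc x hx)
    · exact contDiffAt_const.congr_of_eventuallyEq (hloc0 x fun h ↦ hx (hSH h))
  · exact fun x ↦ indicator_nonneg (fun _ _ ↦ hη0 _) x
  · exact fun x ↦ indicator_le' (fun _ _ ↦ hη1 _) (fun _ _ ↦ zero_le_one) x
  · intro x hx h
    rw [hχ, indicator_of_mem hx]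
    exact ho _ ((le_div_iff₀ hs).2 h)
  · intro x hx
    by_cases hxH : x ∈ H
    · rw [hgr x hxH, hd _ fun h ↦ hx ⟨hxH, (div_le_iff₀ hs).1 h.2⟩]
      ring
    · exact hgr0 x fun h ↦ hxH (hSH h)
  · intro x
    have hg := testFun.gradSq_nonneg f x
    have hrhs : 0 ≤ 4 * K * gradSq f x := by positivity
    by_cases hxH : x ∈ H
    · rw [hgr x hxH]
      by_cases h : f x / s ∈ Icc (1 : ℝ) 2
      · have h2 : (f x / s) ^ 2 ≤ 4 := by nlinarith [h.1, h.2]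
        calc f x ^ 2 * (deriv η (f x / s) ^ 2 * (gradSq f x / s ^ 2))
            = (f x / s) ^ 2 * deriv η (f x / s) ^ 2 * gradSq f x := by
              field_simp
          _ ≤ 4 * K * gradSq f x := by
              have := hK (f x / s)
              gcongr
      · rw [hd _ h]
        simpa using hrhs
    · rw [hgr0 x fun h ↦ hxH (hSH h)]
      simpa using hrhs

lemma exists_volume_sublevel_le {f : ℝ × ℝ → ℝ} (hf : Continuous f) {H : Set (ℝ × ℝ)}
    (hH : MeasurableSet H) (hfin : volume H ≠ ⊤) (hpos : ∀ x ∈ H, 0 < f x) {ε : ℝ} (hε : 0 < ε) :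
    ∃ s₀ > 0, ∀ s ≤ s₀, volume.real (H ∩ {x | f x ≤ 2 * s}) ≤ ε := by
  set A : ℕ → Set (ℝ × ℝ) := fun n ↦ H ∩ {x | f x ≤ 1 / ((n : ℝ) + 1)}
  have hm : ∀ n, MeasurableSet (A n) := fun n ↦
    hH.inter (isClosed_le hf continuous_const).measurableSet
  have hanti : Antitone A := fun m n hmn x hx ↦ by
    have h : f x ≤ 1 / ((n : ℝ) + 1) := hx.2
    exact ⟨hx.1, h.trans (Nat.one_div_le_one_div hmn)⟩
  have hempty : ⋂ n, A n = ∅ := by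
    ext x
    simp only [mem_iInter, mem_empty_iff_false, iff_false, not_forall]
    by_cases hx : x ∈ H
    · obtain ⟨n, hn⟩ := exists_nat_one_div_lt (hpos x hx)
      exact ⟨n, fun h ↦ not_lt.2 h.2 hn⟩
    · exact ⟨0, fun h ↦ hx h.1⟩
  have ht := tendsto_measure_iInter_atTop (μ := volume) (fun n ↦ (hm n).nullMeasurableSet) hanti
    ⟨0, measure_ne_top_of_subset inter_subset_left hfin⟩
  rw [hempty, measure_empty] at ht
  obtain ⟨n, hn⟩ := (ht.eventually (gt_mem_nhds (ENNReal.ofReal_pos.2 hε))).exists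
  refine ⟨1 / (2 * ((n : ℝ) + 1)), by positivity, fun s hs ↦ ?_⟩
  refine ENNReal.toReal_le_of_le_ofReal hε.le ((measure_mono ?_).trans hn.le)
  rintro x ⟨hx, hxs⟩
  have hxs' : f x ≤ 2 * s := hxs
  refine ⟨hx, hxs'.trans ?_⟩
  calc 2 * s ≤ 2 * (1 / (2 * ((n : ℝ) + 1))) := by gcongr
    _ = 1 / ((n : ℝ) + 1) := by field_simp

/-- A smooth function vanishing exactly at `(0, ±R₁)`, comparable to the squared distance to
these points. -/
def crackWeight (R₁ : ℝ) (x : ℝ × ℝ) : ℝ := x.1 ^ 2 + (x.2 ^ 2 - R₁ ^ 2) ^ 2 / R₁ ^ 2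

lemma contDiff_crackWeight (R₁ : ℝ) : ContDiff ℝ (⊤ : ℕ∞) (crackWeight R₁) :=
  (contDiff_fst.pow 2).add ((((contDiff_snd.pow 2).sub contDiff_const).pow 2).div_const _)

lemma sq_fst_le_crackWeight (R₁ : ℝ) (x : ℝ × ℝ) : x.1 ^ 2 ≤ crackWeight R₁ x := by
  unfold crackWeight
  have : 0 ≤ (x.2 ^ 2 - R₁ ^ 2) ^ 2 / R₁ ^ 2 := by positivity
  linarith

lemma gradSq_crackWeight_le {R₁ R₂ : ℝ} (hR₁ : 0 < R₁) {x : ℝ × ℝ} (hx : x ∈ disk R₂) :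
    gradSq (crackWeight R₁) x ≤ (4 + 16 * R₂ ^ 2 / R₁ ^ 2) * crackWeight R₁ x := by
  have h1 : HasFDerivAt (fun y : ℝ × ℝ ↦ y.1) (ContinuousLinearMap.fst ℝ ℝ ℝ) x := hasFDerivAt_fst
  have h2 : HasFDerivAt (fun y : ℝ × ℝ ↦ y.2) (ContinuousLinearMap.snd ℝ ℝ ℝ) x := hasFDerivAt_snd
  have h := ((h1.pow 2).add ((((h2.pow 2).sub_const (R₁ ^ 2)).pow 2).const_mul (R₁ ^ 2)⁻¹)).fderiv
  have e : crackWeight R₁ = (fun y : ℝ × ℝ ↦ y.1 ^ 2) + fun y : ℝ × ℝ ↦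
      (R₁ ^ 2)⁻¹ * (y.2 ^ 2 - R₁ ^ 2) ^ 2 := by
    ext y
    simp [crackWeight, div_eq_inv_mul]
  have hg : gradSq (crackWeight R₁) x =
      4 * x.1 ^ 2 + 16 * x.2 ^ 2 * (x.2 ^ 2 - R₁ ^ 2) ^ 2 / R₁ ^ 4 := by
    unfold gradSq
    rw [e, h]
    simp
    field_simp
    ring
  rw [hg, crackWeight]
  have hy : x.2 ^ 2 ≤ R₂ ^ 2 := by
    have : x.1 ^ 2 + x.2 ^ 2 < R₂ ^ 2 := hx
    nlinarith [sq_nonneg x.1]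
  have h3 : 16 * x.2 ^ 2 * (x.2 ^ 2 - R₁ ^ 2) ^ 2 / R₁ ^ 4 ≤
      16 * R₂ ^ 2 * (x.2 ^ 2 - R₁ ^ 2) ^ 2 / R₁ ^ 4 := by gcongr
  have h4 : (4 + 16 * R₂ ^ 2 / R₁ ^ 2) * (x.1 ^ 2 + (x.2 ^ 2 - R₁ ^ 2) ^ 2 / R₁ ^ 2) =
      4 * x.1 ^ 2 + 16 * R₂ ^ 2 * (x.2 ^ 2 - R₁ ^ 2) ^ 2 / R₁ ^ 4 +
      (4 * ((x.2 ^ 2 - R₁ ^ 2) ^ 2 / R₁ ^ 2) + 16 * R₂ ^ 2 / R₁ ^ 2 * x.1 ^ 2) := by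
    field_simp
    ring
  rw [h4]
  have : 0 ≤ 4 * ((x.2 ^ 2 - R₁ ^ 2) ^ 2 / R₁ ^ 2) + 16 * R₂ ^ 2 / R₁ ^ 2 * x.1 ^ 2 := by
    positivity
  linarith

lemma sq_add_sq_of_mem_crackSet {R₁ δ : ℝ} {x : ℝ × ℝ} (hx : x ∈ crackSet R₁ δ) :
    x.1 ^ 2 + x.2 ^ 2 = R₁ ^ 2 := by
  obtain ⟨θ, -, rfl⟩ := hx
  linear_combination R₁ ^ 2 * sin_sq_add_cos_sq θ

lemma crackWeight_le_of_mem_crackSet {R₁ δ : ℝ} (hR₁ : 0 < R₁) {x : ℝ × ℝ}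
    (hx : x ∈ crackSet R₁ δ) : crackWeight R₁ x ≤ 2 * R₁ ^ 2 * δ ^ 2 := by
  have hsq := sq_add_sq_of_mem_crackSet hx
  have hcos : x.1 ^ 2 ≤ R₁ ^ 2 * δ ^ 2 := by
    obtain ⟨θ, hθ, rfl⟩ := hx
    have key : ∀ φ : ℝ, -δ ≤ φ → φ ≤ δ → sin φ ^ 2 ≤ δ ^ 2 := fun φ h1 h2 ↦
      sq_le_sq.2 ((abs_sin_le_abs.trans (abs_le.2 ⟨h1, h2⟩)).trans (le_abs_self δ))
    have : cos θ ^ 2 ≤ δ ^ 2 := by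
      rcases hθ with h | h
      · have := key (π / 2 - θ) (by linarith [h.2]) (by linarith [h.1])
        rwa [sin_pi_div_two_sub] at this
      · have := key (θ + π / 2) (by linarith [h.1]) (by linarith [h.2])
        rwa [sin_add_pi_div_two] at this
    simp only [mul_pow]
    gcongr
  have h1 : x.2 ^ 2 - R₁ ^ 2 = -x.1 ^ 2 := by linarith
  have h2 : (x.1 ^ 2) ^ 2 / R₁ ^ 2 ≤ x.1 ^ 2 := by
    rw [div_le_iff₀ (by positivity)]
    nlinarith [sq_nonneg x.1, sq_nonneg x.2]
  rw [crackWeight, h1, neg_sq]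
  linarith

lemma crackWeight_sublevel_subset {R₁ b : ℝ} (hR₁ : 0 < R₁) (hb : 0 ≤ b) :
    {x | crackWeight R₁ x ≤ b ^ 2} ⊆ Icc (-b) b ×ˢ Icc (R₁ - b) (R₁ + b) ∪
      Icc (-b) b ×ˢ Icc (-R₁ - b) (-R₁ + b) := by
  intro x hx
  have hx' : x.1 ^ 2 + (x.2 ^ 2 - R₁ ^ 2) ^ 2 / R₁ ^ 2 ≤ b ^ 2 := hx
  have h1 : |x.1| ≤ b := abs_le_of_sq_le_sq ((sq_fst_le_crackWeight R₁ x).trans hx) hb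
  have h2 : (|x.2| - R₁) ^ 2 ≤ b ^ 2 := by
    have e : (x.2 ^ 2 - R₁ ^ 2) ^ 2 / R₁ ^ 2 = (|x.2| - R₁) ^ 2 * ((|x.2| + R₁) / R₁) ^ 2 := by
      rw [← sq_abs x.2]
      field_simp
      ring
    have h3 : 1 ≤ ((|x.2| + R₁) / R₁) ^ 2 := by
      refine one_le_pow₀ ((one_le_div hR₁).2 ?_)
      linarith [abs_nonneg x.2]
    calc (|x.2| - R₁) ^ 2 ≤ (|x.2| - R₁) ^ 2 * ((|x.2| + R₁) / R₁) ^ 2 :=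
          le_mul_of_one_le_right (sq_nonneg _) h3
      _ ≤ b ^ 2 := by rw [← e]; nlinarith [sq_nonneg x.1]
  have h4 := abs_le.1 (abs_le_of_sq_le_sq h2 hb)
  have h5 : x.1 ∈ Icc (-b) b := abs_le.1 h1
  rcases le_total 0 x.2 with h | h
  · rw [abs_of_nonneg h] at h4
    exact Or.inl ⟨h5, by linarith [h4.1], by linarith [h4.2]⟩
  · rw [abs_of_nonpos h] at h4
    exact Or.inr ⟨h5, by linarith [h4.2], by linarith [h4.1]⟩

lemma volume_real_box {a b c d : ℝ} (hab : a ≤ b) (hcd : c ≤ d) :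
    volume.real (Icc a b ×ˢ Icc c d) = (b - a) * (d - c) := by
  rw [Measure.volume_eq_prod, measureReal_prod_prod, Real.volume_real_Icc_of_le hab,
    Real.volume_real_Icc_of_le hcd]

lemma volume_crackWeight_sublevel {R₁ b : ℝ} (hR₁ : 0 < R₁) (hb : 0 ≤ b) :
    volume {x | crackWeight R₁ x ≤ b ^ 2} ≠ ⊤ ∧
      volume.real {x | crackWeight R₁ x ≤ b ^ 2} ≤ 8 * b ^ 2 := by
  have hfin : volume (Icc (-b) b ×ˢ Icc (R₁ - b) (R₁ + b) ∪
      Icc (-b) b ×ˢ Icc (-R₁ - b) (-R₁ + b)) ≠ ⊤ :=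
    ((isCompact_Icc.prod isCompact_Icc).union (isCompact_Icc.prod isCompact_Icc)).measure_ne_top
  refine ⟨measure_ne_top_of_subset (crackWeight_sublevel_subset hR₁ hb) hfin, ?_⟩
  refine (measureReal_mono (crackWeight_sublevel_subset hR₁ hb) hfin).trans
    ((measureReal_union_le _ _).trans ?_)
  rw [volume_real_box (by linarith) (by linarith), volume_real_box (by linarith) (by linarith)]
  exact le_of_eq (by ring)

lemma reflectFst_mem_disk_diff_crackSet {R₁ R₂ δ : ℝ} :
    ∀ x ∈ disk R₂ \ crackSet R₁ δ, reflectFst x ∈ disk R₂ \ crackSet R₁ δ := by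
  rintro x ⟨hx, hn⟩
  refine ⟨?_, fun ⟨θ, hθ, he⟩ ↦ hn ?_⟩
  · change (-x.1) ^ 2 + x.2 ^ 2 < R₂ ^ 2
    rw [neg_sq]
    exact hx
  · rw [reflectFst_apply, Prod.mk.injEq] at he
    rcases hθ with h | h
    · refine ⟨π - θ, Or.inl ⟨by linarith [h.2], by linarith [h.1]⟩, ?_⟩
      rw [cos_pi_sub, sin_pi_sub]
      exact Prod.ext (by simp only; linarith [he.1]) he.2
    · refine ⟨-(θ + π), Or.inr ⟨by linarith [h.2], by linarith [h.1]⟩, ?_⟩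
      rw [cos_neg, sin_neg, cos_add_pi, sin_add_pi, neg_neg]
      exact Prod.ext (by simp only; linarith [he.1]) he.2

lemma sq_mul_gradSq_crackCutoff_le {η : ℝ → ℝ} {K : ℝ} (hη : Differentiable ℝ η)
    (hd : ∀ t, t ∉ Icc (1 : ℝ) 2 → deriv η t = 0) (hK : ∀ t, deriv η t ^ 2 ≤ K)
    {R₁ R₂ a M f : ℝ} (hR₁ : 0 < R₁) (ha : 0 < a) (hM : 0 ≤ M) {x : ℝ × ℝ} (hx : x ∈ disk R₂)
    (hf : f ^ 2 ≤ M * x.1 ^ 2) :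
    f ^ 2 * gradSq (fun y ↦ η (crackWeight R₁ y / a)) x ≤
      {x | crackWeight R₁ x ≤ 2 * a}.indicator
        (fun _ ↦ 4 * K * M * (4 + 16 * R₂ ^ 2 / R₁ ^ 2)) x := by
  set σ := crackWeight R₁ x with hσ
  have hK0 : 0 ≤ K := (sq_nonneg _).trans (hK 0)
  have hσ0 : 0 ≤ σ := (sq_nonneg _).trans (sq_fst_le_crackWeight R₁ x)
  have hsm : Differentiable ℝ fun y ↦ crackWeight R₁ y / a :=
    ((contDiff_crackWeight R₁).div_const a).differentiable (by simp)
  rw [gradSq_comp hη (hsm x), gradSq_div_const]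
  have hrhs : 0 ≤ {x | crackWeight R₁ x ≤ 2 * a}.indicator
      (fun _ ↦ 4 * K * M * (4 + 16 * R₂ ^ 2 / R₁ ^ 2)) x :=
    indicator_nonneg (fun _ _ ↦ by positivity) x
  by_cases h : σ / a ∈ Icc (1 : ℝ) 2
  · have h2 : σ ≤ 2 * a := (div_le_iff₀ ha).1 h.2
    have hmem : x ∈ {x | crackWeight R₁ x ≤ 2 * a} := h2
    rw [indicator_of_mem hmem]
    have hfσ : f ^ 2 ≤ M * σ := hf.trans (by gcongr; exact sq_fst_le_crackWeight R₁ x)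
    have hg : gradSq (crackWeight R₁) x ≤ (4 + 16 * R₂ ^ 2 / R₁ ^ 2) * σ :=
      gradSq_crackWeight_le hR₁ hx
    have hg0 := testFun.gradSq_nonneg (crackWeight R₁) x
    have hq : (σ / a) ^ 2 ≤ 4 := by nlinarith [h.1, h.2]
    calc f ^ 2 * (deriv η (σ / a) ^ 2 * (gradSq (crackWeight R₁) x / a ^ 2))
        ≤ (M * σ) * (K * ((4 + 16 * R₂ ^ 2 / R₁ ^ 2) * σ / a ^ 2)) := by
          have := hK (σ / a)
          gcongr
      _ = K * M * (4 + 16 * R₂ ^ 2 / R₁ ^ 2) * (σ / a) ^ 2 := by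
          field_simp
      _ ≤ K * M * (4 + 16 * R₂ ^ 2 / R₁ ^ 2) * 4 := by gcongr
      _ = 4 * K * M * (4 + 16 * R₂ ^ 2 / R₁ ^ 2) := by ring
  · rw [hd _ h]
    simpa using hrhs

lemma isOpen_disk (R : ℝ) : IsOpen (disk R) :=
  isOpen_lt (by fun_prop : Continuous fun x : ℝ × ℝ ↦ x.1 ^ 2 + x.2 ^ 2) continuous_const

lemma isCompact_closedHalfDisk (R : ℝ) :
    IsCompact {x : ℝ × ℝ | x.1 ^ 2 + x.2 ^ 2 ≤ R ^ 2 ∧ 0 ≤ x.1} := by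
  refine (isCompact_Icc.prod isCompact_Icc).of_isClosed_subset
    (s := Icc (-|R|) |R| ×ˢ Icc (-|R|) |R|) ?_ ?_
  · exact (isClosed_le (by fun_prop : Continuous fun x : ℝ × ℝ ↦ x.1 ^ 2 + x.2 ^ 2)
      continuous_const).inter
      (isClosed_le continuous_const continuous_fst)
  · rintro x ⟨hx, -⟩
    exact ⟨abs_le.1 (sq_le_sq.1 (by nlinarith [sq_nonneg x.2])),
      abs_le.1 (sq_le_sq.1 (by nlinarith [sq_nonneg x.1]))⟩

/-- For small cracks the second eigenvalue increases at most quadratically in the crack length. -/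
lemma exists_dirichletEV_crack_le {R₁ R₂ t₁ : ℝ} (hR₁ : 0 < R₁) (hR₂ : 0 < R₂) (ht₁ : 0 < t₁)
    (hz : besselSeries 1 t₁ = 0) (hb1 : ∀ t ∈ Ico 0 t₁, 0 < besselSeries 1 t) :
    ∃ C, 0 ≤ C ∧ ∃ δ₀ > 0, ∀ δ, 0 < δ → δ ≤ δ₀ →
      dirichletEV (disk R₂ \ crackSet R₁ δ) 2 ≤ 4 * (t₁ / R₂ ^ 2) + C * δ ^ 2 := by
  obtain ⟨η, hη, hη0, hη1, hηz, hηo, hηd, K, hK⟩ := exists_smooth_step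
  have hK0 : 0 ≤ K := (sq_nonneg _).trans (hK 0)
  set κ := t₁ / R₂ ^ 2 with hκdef
  have hκ : 0 < κ := by positivity
  have hκR : κ * R₂ ^ 2 = t₁ := by rw [hκdef]; field_simp
  set f := oddMode κ with hfdef
  have hf := contDiff_oddMode κ
  have hfc := continuous_oddMode κ
  set H : Set (ℝ × ℝ) := disk R₂ ∩ {x | 0 < x.1} with hHdef
  set Cl : Set (ℝ × ℝ) := {x : ℝ × ℝ | x.1 ^ 2 + x.2 ^ 2 ≤ R₂ ^ 2 ∧ 0 ≤ x.1} with hCldef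
  have hH : IsOpen H := (isOpen_disk R₂).inter (isOpen_lt continuous_const continuous_fst)
  have hCl : IsCompact Cl := isCompact_closedHalfDisk R₂
  have hHC : H ⊆ Cl := fun x hx ↦ ⟨le_of_lt hx.1, le_of_lt hx.2⟩
  have hpos : ∀ x ∈ H, 0 < f x := fun x hx ↦ oddMode_pos hκ hκR hb1 hx
  have hbd : ∀ x ∈ Cl, x ∉ H → f x ≤ 0 := by
    rintro x ⟨h1, h2⟩ hx
    rcases h2.eq_or_lt with h | h
    · simp [hfdef, oddMode, ← h]
    · have : x.1 ^ 2 + x.2 ^ 2 = R₂ ^ 2 :=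
        h1.antisymm (not_lt.1 fun hlt ↦ hx ⟨hlt, h⟩)
      simp [hfdef, oddMode, this, hκR, hz]
  obtain ⟨G, hG⟩ := hCl.exists_bound_of_continuousOn
    (testFun.continuous_gradSq hf).continuousOn
  obtain ⟨M, hM⟩ := hCl.exists_bound_of_continuousOn
    (f := fun x : ℝ × ℝ ↦ besselSeries 1 (κ * (x.1 ^ 2 + x.2 ^ 2))) (by
      have := (contDiff_besselSeries 1).continuous
      fun_prop)
  have h0Cl : (0 : ℝ × ℝ) ∈ Cl := ⟨by simp; positivity, le_rfl⟩
  have hG0 : 0 ≤ G := (norm_nonneg _).trans (hG 0 h0Cl)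
  have hfM : ∀ x ∈ Cl, f x ^ 2 ≤ M ^ 2 * x.1 ^ 2 := fun x hx ↦ by
    rw [hfdef, oddMode, mul_pow, mul_comm]
    have := pow_le_pow_left₀ (norm_nonneg _) (hM x hx) 2
    rw [norm_eq_abs, sq_abs] at this
    gcongr
  set Q : Set (ℝ × ℝ) := Icc (R₂ / 4) (R₂ / 2) ×ˢ Icc 0 (R₂ / 4) with hQ
  have hQc : IsCompact Q := isCompact_Icc.prod isCompact_Icc
  have hQH : Q ⊆ H := by
    rintro ⟨x, y⟩ ⟨⟨h1, h2⟩, h3, h4⟩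
    simp only at h1 h2 h3 h4
    refine ⟨?_, ?_⟩
    · change x ^ 2 + y ^ 2 < R₂ ^ 2
      nlinarith
    · change 0 < x
      linarith
  obtain ⟨z, hzQ, hzmin⟩ := hQc.exists_isMinOn
    ⟨(R₂ / 4, 0), ⟨⟨le_rfl, by linarith⟩, le_rfl, by linarith⟩⟩ hfc.continuousOn
  set m := f z
  have hm : 0 < m := hpos z (hQH hzQ)
  have hQm : ∀ x ∈ Q, m ≤ f x := fun x hx ↦ hzmin hx
  set C₁ := 4 + 16 * R₂ ^ 2 / R₁ ^ 2 with hC₁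
  have hC₁0 : 0 ≤ C₁ := by positivity
  set P := 8 * K * G + 2 * (4 * K * M ^ 2 * C₁) * (8 * (4 * R₁) ^ 2) with hP
  have hP0 : 0 ≤ P := by positivity
  have hD : 0 < m ^ 2 * (R₂ / 4) ^ 2 := by positivity
  refine ⟨P / (m ^ 2 * (R₂ / 4) ^ 2), by positivity, R₂ / (16 * R₁), by positivity,
    fun δ hδ hδ₀ ↦ ?_⟩
  set b := 4 * R₁ * δ with hb
  have hb0 : 0 < b := by positivity
  have hbR : b ≤ R₂ / 4 := by
    rw [le_div_iff₀ (by positivity)] at hδ₀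
    rw [hb]; linarith
  set a := b ^ 2 / 2 with ha
  have ha0 : 0 < a := by positivity
  have h2a : 2 * a = b ^ 2 := by rw [ha]; ring
  have hHfin : volume H ≠ ⊤ := measure_ne_top_of_subset hHC hCl.measure_ne_top
  obtain ⟨s₀, hs₀, hvol⟩ := exists_volume_sublevel_le hfc hH.measurableSet hHfin hpos
    (by positivity : 0 < δ ^ 2)
  set s := min s₀ (m / 2)
  have hs : 0 < s := lt_min hs₀ (by positivity)
  have hsm : 2 * s ≤ m := by linarith [min_le_right s₀ (m / 2)]
  obtain ⟨χ₁, hχ₁, hχ₁0, hχ₁1, hχ₁o, hχ₁g, hχ₁b⟩ :=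
    exists_levelSet_cutoff hη hη0 hη1 hηz hηo hηd hK hf hH hCl hHC hbd hs
  set χ₂ : ℝ × ℝ → ℝ := fun y ↦ η (crackWeight R₁ y / a) with hχ₂
  have hχ₂s : ContDiff ℝ (⊤ : ℕ∞) χ₂ := hη.comp ((contDiff_crackWeight R₁).div_const a)
  set χ : ℝ × ℝ → ℝ := fun y ↦ χ₁ y * χ₂ y with hχ
  have hχs : ContDiff ℝ (⊤ : ℕ∞) χ := hχ₁.1.mul hχ₂s
  have hχc : HasCompactSupport χ := hχ₁.2.1.mul_right
  have hχH : tsupport χ ⊆ H := (tsupport_mul_subset_left (f := χ₁) (g := χ₂)).trans hχ₁.2.2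
  have hχ₂t : tsupport χ₂ ⊆ {x | a ≤ crackWeight R₁ x} := by
    refine closure_minimal (fun x hx ↦ ?_)
      (isClosed_le continuous_const (contDiff_crackWeight R₁).continuous)
    by_contra hlt
    refine hx (hηz _ ?_)
    rw [div_le_one ha0]
    exact (not_le.1 hlt).le
  set w : ℝ × ℝ → ℝ := fun y ↦ f y * χ y with hw
  have hwt : testFun ((disk R₂ \ crackSet R₁ δ) ∩ {x | 0 < x.1}) w := by
    refine ⟨hf.mul hχs, hχc.mul_left, fun x hx ↦ ?_⟩
    have hxχ : x ∈ tsupport χ := tsupport_mul_subset_right (f := f) (g := χ) hx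
    refine ⟨⟨(hχH hxχ).1, fun hxc ↦ ?_⟩, (hχH hxχ).2⟩
    have h1 : a ≤ crackWeight R₁ x :=
      hχ₂t (tsupport_mul_subset_right (f := χ₁) (g := χ₂) hxχ)
    have h2 := crackWeight_le_of_mem_crackSet hR₁ hxc
    have h3 : a = 8 * R₁ ^ 2 * δ ^ 2 := by rw [ha, hb]; ring
    have h4 : 0 < R₁ ^ 2 * δ ^ 2 := by positivity
    linarith
  have hwQ : ∀ x ∈ Q, m ^ 2 ≤ w x ^ 2 := fun x hx ↦ by
    have h1 : χ₁ x = 1 := hχ₁o x (hQH hx) (hsm.trans (hQm x hx))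
    have h2 : χ₂ x = 1 := by
      refine hηo _ ((le_div_iff₀ ha0).2 ?_)
      rw [h2a]
      refine le_trans ?_ (sq_fst_le_crackWeight R₁ x)
      exact pow_le_pow_left₀ hb0.le (hbR.trans hx.1.1) 2
    simp only [hw, hχ, h1, h2, mul_one]
    exact pow_le_pow_left₀ hm.le (hQm x hx) 2
  have hwi : Integrable fun x ↦ w x ^ 2 := hwt.integrable_sq
  have hN : m ^ 2 * (R₂ / 4) ^ 2 ≤ ∫ x, w x ^ 2 := by
    calc m ^ 2 * (R₂ / 4) ^ 2 = ∫ x, Q.indicator (fun _ ↦ m ^ 2) x := by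
          rw [integral_indicator_const _ hQc.measurableSet, hQ,
            volume_real_box (by linarith) (by linarith), smul_eq_mul]
          ring
      _ ≤ ∫ x, w x ^ 2 := by
          refine integral_mono ((integrable_indicator_iff hQc.measurableSet).2
            (integrableOn_const hQc.measure_ne_top)) hwi fun x ↦ ?_
          exact indicator_le' (fun x hx ↦ hwQ x hx) (fun x _ ↦ sq_nonneg _) x
  have hw0 : w ≠ 0 := fun h ↦ by
    rw [h] at hN
    simp only [Pi.zero_apply, ne_eq, OfNat.ofNat_ne_zero, not_false_eq_true, zero_pow,
      integral_zero] at hN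
    linarith
  set A₁ := H ∩ {x | f x ≤ 2 * s} with hA₁
  set A₂ := {x | crackWeight R₁ x ≤ 2 * a} with hA₂
  have hA₁m : MeasurableSet A₁ :=
    hH.measurableSet.inter (isClosed_le hfc continuous_const).measurableSet
  have hA₂m : MeasurableSet A₂ :=
    (isClosed_le (contDiff_crackWeight R₁).continuous continuous_const).measurableSet
  have hA₁f : volume A₁ ≠ ⊤ := measure_ne_top_of_subset inter_subset_left hHfin
  have hA₂v := volume_crackWeight_sublevel hR₁ hb0.le
  rw [← h2a] at hA₂v
  have hpt : ∀ x, f x ^ 2 * gradSq χ x ≤ A₁.indicator (fun _ ↦ 8 * K * G) x +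
      A₂.indicator (fun _ ↦ 2 * (4 * K * M ^ 2 * C₁)) x := by
    intro x
    have i1 : 0 ≤ A₁.indicator (fun _ ↦ 8 * K * G) x :=
      indicator_nonneg (fun _ _ ↦ by positivity) x
    have i2 : 0 ≤ A₂.indicator (fun _ ↦ 2 * (4 * K * M ^ 2 * C₁)) x :=
      indicator_nonneg (fun _ _ ↦ by positivity) x
    by_cases hx : x ∈ H
    · have b1 : f x ^ 2 * gradSq χ₁ x * 2 ≤ A₁.indicator (fun _ ↦ 8 * K * G) x := by
        by_cases hxA : x ∈ A₁
        · rw [indicator_of_mem hxA]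
          have h1 := hχ₁b x
          have h2 : gradSq f x ≤ G := (le_abs_self _).trans (hG x (hHC hx))
          have h3 := mul_le_mul_of_nonneg_left h2 hK0
          linarith
        · rw [hχ₁g x hxA, indicator_of_notMem hxA]
          simp
      have b2 : f x ^ 2 * gradSq χ₂ x * 2 ≤
          A₂.indicator (fun _ ↦ 2 * (4 * K * M ^ 2 * C₁)) x := by
        have := sq_mul_gradSq_crackCutoff_le (hη.differentiable (by simp)) hηd hK hR₁ ha0
          (sq_nonneg M) hx.1 (hfM x (hHC hx))
        rw [indicator_const_mul]
        linarith
      have b3 := gradSq_mul_le (hχ₁.differentiable x) (hχ₂s.differentiable (by simp) x)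
        (hχ₁0 x) (hχ₁1 x) (hη0 _) (hη1 _)
      have b4 := mul_le_mul_of_nonneg_left b3 (sq_nonneg (f x))
      linarith
    · rw [testFun.gradSq_eq_zero fun h ↦ hx (hχH h), mul_zero]
      positivity
  have hI : ∫ x, f x ^ 2 * gradSq χ x ≤ P * δ ^ 2 := by
    have j1 : Integrable (A₁.indicator fun _ : ℝ × ℝ ↦ 8 * K * G) :=
      (integrable_indicator_iff hA₁m).2 (integrableOn_const hA₁f)
    have j2 : Integrable (A₂.indicator fun _ : ℝ × ℝ ↦ 2 * (4 * K * M ^ 2 * C₁)) :=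
      (integrable_indicator_iff hA₂m).2 (integrableOn_const hA₂v.1)
    have j3 : Integrable fun x ↦ f x ^ 2 * gradSq χ x :=
      ((hfc.pow 2).mul (testFun.continuous_gradSq hχs)).integrable_of_hasCompactSupport
        (HasCompactSupport.intro hχc fun x hx ↦ by simp [testFun.gradSq_eq_zero hx])
    refine (integral_mono j3 (j1.add j2) hpt).trans ?_
    simp only [Pi.add_apply]
    rw [integral_add j1 j2, integral_indicator_const _ hA₁m, integral_indicator_const _ hA₂m,
      smul_eq_mul, smul_eq_mul]
    have v1 : volume.real A₁ ≤ δ ^ 2 := hvol s (min_le_left _ _)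
    have v2 : volume.real A₂ ≤ 8 * (4 * R₁) ^ 2 * δ ^ 2 := by
      refine hA₂v.2.trans_eq ?_
      rw [h2a, hb]; ring
    calc volume.real A₁ * (8 * K * G) + volume.real A₂ * (2 * (4 * K * M ^ 2 * C₁))
        ≤ δ ^ 2 * (8 * K * G) + 8 * (4 * R₁) ^ 2 * δ ^ 2 * (2 * (4 * K * M ^ 2 * C₁)) := by
          gcongr
      _ = P * δ ^ 2 := by rw [hP]; ring
  refine (dirichletEV_two_le_of_reflection reflectFst_mem_disk_diff_crackSet hwt hw0).trans ?_
  have hNpos : 0 < ∫ x, w x ^ 2 := hD.trans_le hN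
  rw [integral_gradSq_mul_eq hf hχs hχc (laplacian_oddMode κ), div_le_iff₀ hNpos, add_mul]
  have : P * δ ^ 2 ≤ P / (m ^ 2 * (R₂ / 4) ^ 2) * δ ^ 2 * ∫ x, w x ^ 2 := by
    calc P * δ ^ 2 = P / (m ^ 2 * (R₂ / 4) ^ 2) * δ ^ 2 * (m ^ 2 * (R₂ / 4) ^ 2) := by
          field_simp
      _ ≤ _ := by gcongr
  exact add_le_add le_rfl (hI.trans this)

lemma exists_testFun_disk_diff_crackSet {R₁ R₂ : ℝ} (hR₁ : 0 < R₁) (hR₁₂ : R₁ < R₂) :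
    ∃ v : ℝ × ℝ → ℝ, v ≠ 0 ∧
      ∀ δ, testFun ((disk R₂ \ crackSet R₁ δ) ∩ {x | 0 < x.1}) v := by
  let g : ContDiffBump ((R₁ / 2, 0) : ℝ × ℝ) := ⟨R₁ / 8, R₁ / 4, by positivity, by linarith⟩
  refine ⟨g, fun h ↦ ?_, fun δ ↦ ⟨g.contDiff, g.hasCompactSupport, fun x hx ↦ ?_⟩⟩
  · have h1 : g (R₁ / 2, 0) = 1 := g.one_of_mem_closedBall (Metric.mem_closedBall_self (by
      simpa using g.rIn_pos.le))
    rw [h] at h1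
    simp at h1
  · rw [g.tsupport_eq, Metric.mem_closedBall, Prod.dist_eq, max_le_iff, Real.dist_eq,
      Real.dist_eq, abs_le, abs_le] at hx
    obtain ⟨⟨h1, h2⟩, h3, h4⟩ := hx
    simp only [sub_zero] at h1 h2 h3 h4
    change -(R₁ / 4) ≤ _ at h1
    change _ ≤ R₁ / 4 at h2
    change -(R₁ / 4) ≤ _ at h3
    change _ ≤ R₁ / 4 at h4
    have hr : x.1 ^ 2 + x.2 ^ 2 < R₁ ^ 2 := by nlinarith
    refine ⟨⟨?_, fun hc ↦ hr.ne (sq_add_sq_of_mem_crackSet hc)⟩, ?_⟩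
    · change x.1 ^ 2 + x.2 ^ 2 < R₂ ^ 2
      nlinarith
    · change 0 < x.1
      linarith

/-- the NDD case: `λ₂(B_{R₂}) ≤ λ₂(B_{R₂} \ K_δ) ≤ λ₂(B_{R₂}) + Cδ²`. -/
theorem NDD_eigenvalue_bounds (R₁ R₂ : ℝ) (hR₁ : 0 < R₁) (hR₁₂ : R₁ < R₂) :
    ∃ C : ℝ, 0 < C ∧ ∀ δ ∈ Set.Ioo (0 : ℝ) (π / 2),
      dirichletEV (disk R₂) 2 ≤ dirichletEV (disk R₂ \ crackSet R₁ δ) 2 ∧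
      dirichletEV (disk R₂ \ crackSet R₁ δ) 2 ≤ dirichletEV (disk R₂) 2 + C * δ ^ 2 := by
  obtain ⟨t₀, t₁, ht₀, ht, hz₁, hb1, hz₀, hb0, hb0'⟩ := exists_besselSeries_zeros
  have hR₂ : 0 < R₂ := hR₁.trans hR₁₂
  have ht₁ : 0 < t₁ := ht₀.trans ht
  obtain ⟨v, hv0, hv⟩ := exists_testFun_disk_diff_crackSet hR₁ hR₁₂
  set M := (∫ x, gradSq v x) / ∫ x, v x ^ 2 with hMdef
  have hM : 0 ≤ M := div_nonneg (integral_nonneg fun x ↦ testFun.gradSq_nonneg v x)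
    (integral_nonneg fun _ ↦ sq_nonneg _)
  have hne (δ : ℝ) : ∃ V : Submodule ℝ ((ℝ × ℝ) → ℝ),
      (V : Set ((ℝ × ℝ) → ℝ)) ⊆ {u | testFun (disk R₂ \ crackSet R₁ δ) u} ∧
        Module.finrank ℝ V = 2 := by
    obtain ⟨V, hV, h2, -⟩ := exists_submodule_of_reflection reflectFst_mem_disk_diff_crackSet
      (hv δ) hv0
    exact ⟨V, hV, h2⟩
  have hlow : 4 * (t₁ / R₂ ^ 2) ≤ dirichletEV (disk R₂) 2 := by
    obtain ⟨V, hV, h2⟩ := hne 0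
    refine le_csInf ⟨_, V, fun u hu ↦ (hV hu).mono sdiff_subset, h2, rfl⟩ ?_
    rintro _ ⟨W, hW, hW2, rfl⟩
    exact le_sSup_rayleigh_disk hR₂ ht₀ ht hb1 hz₀ hb0 hb0' hW hW2
  obtain ⟨C, hC, δ₀, hδ₀, hup⟩ := exists_dirichletEV_crack_le hR₁ hR₂ ht₁ hz₁ hb1
  refine ⟨C + M / δ₀ ^ 2 + 1, by positivity, fun δ hδ ↦
    ⟨dirichletEV_mono sdiff_subset (hne δ), ?_⟩⟩
  have hsplit : (C + M / δ₀ ^ 2 + 1) * δ ^ 2 = C * δ ^ 2 + M / δ₀ ^ 2 * δ ^ 2 + δ ^ 2 := by ring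
  have hCδ : 0 ≤ C * δ ^ 2 := by positivity
  have hMδ : 0 ≤ M / δ₀ ^ 2 * δ ^ 2 := by positivity
  have hδ2 : 0 ≤ δ ^ 2 := sq_nonneg δ
  rcases le_or_gt δ δ₀ with h | h
  · linarith [hup δ hδ.1 h]
  · have h1 : dirichletEV (disk R₂ \ crackSet R₁ δ) 2 ≤ M :=
      dirichletEV_two_le_of_reflection reflectFst_mem_disk_diff_crackSet (hv δ) hv0
    have h2 : M ≤ M / δ₀ ^ 2 * δ ^ 2 := by
      calc M = M / δ₀ ^ 2 * δ₀ ^ 2 := by field_simp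
        _ ≤ M / δ₀ ^ 2 * δ ^ 2 := by gcongr
    have h3 : 0 ≤ 4 * (t₁ / R₂ ^ 2) := by positivity
    linarith
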